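/- arXiv:2112.00535 — 13 statements merged into one kernel-verified Lean document; each statement's English description precedes it below -/
import Mathlib

section
/- Let κ be an uncountable cardinal. If the Cantor space 2^ω admits a partition into exactly κ nonempty closed sets, then the Baire space ω^ω admits a partition into exactly κ nonempty compact sets. -/
open Cardinal

theorem ccp_split {X : Type} [TopologicalSpace X] [CompactSpace X] [T2Space X]
    [SecondCountableTopology X] [TotallyDisconnectedSpace X]
    (c : X → Bool) (hc : Continuous c) (C F : Set X) (hC : IsClopen C)
    (hF : IsClosed F) (hFi : interior F = ∅) (hCF : (C ∩ F).Nonempty) :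
    ∃ A : ℕ → Set X, (∀ i, IsClopen (A i)) ∧ (∀ i, (A i).Nonempty) ∧
      (∀ i j, ∀ x, x ∈ A i → x ∈ A j → i = j) ∧ (⋃ i, A i = C \ F) ∧
      (∀ i, ∀ x ∈ A i, ∀ y ∈ A i, c x = c y) := by
  have hopen : IsOpen (C \ F) := hC.isOpen.sdiff hF
  have hnc : ¬ IsClosed (C \ F) := by
    intro h
    have h1 : IsOpen (C ∩ F) := by
      have : C ∩ F = C \ (C \ F) := by ext x; simp
      rw [this]
      exact hC.isOpen.sdiff h
    have h2 : C ∩ F ⊆ interior F := interior_maximal Set.inter_subset_right h1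
    rw [hFi] at h2
    obtain ⟨x, hx⟩ := hCF
    exact h2 hx
  -- local clopen neighbourhoods
  have hloc : ∀ x : (C \ F : Set X), ∃ V : Set X, IsClopen V ∧ x.1 ∈ V ∧ V ⊆ C \ F ∧
      ∀ y ∈ V, c y = c x.1 := by
    intro x
    have ho : IsOpen ((C \ F) ∩ c ⁻¹' {c x.1}) :=
      hopen.inter ((isOpen_discrete _).preimage hc)
    obtain ⟨V, hV, hxV, hVs⟩ := compact_exists_isClopen_in_isOpen ho
      (show x.1 ∈ (C \ F) ∩ c ⁻¹' {c x.1} from ⟨x.2, rfl⟩)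
    exact ⟨V, hV, hxV, fun y hy => (hVs hy).1, fun y hy => (hVs hy).2⟩
  choose V hV hxV hVs hVc using hloc
  obtain ⟨T, hTc, hT⟩ := TopologicalSpace.isOpen_iUnion_countable V (fun x => (hV x).isOpen)
  have hTU : ⋃ i ∈ T, V i = C \ F := by
    rw [hT]
    apply Set.Subset.antisymm
    · exact Set.iUnion_subset hVs
    · intro x hx
      exact Set.mem_iUnion.2 ⟨⟨x, hx⟩, hxV ⟨x, hx⟩⟩
  have hTne : T.Nonempty := by
    by_contra h
    rw [Set.not_nonempty_iff_eq_empty] at h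
    subst h
    simp at hTU
    rw [← hTU] at hnc
    exact hnc isClosed_empty
  obtain ⟨f, hf⟩ := hTc.exists_eq_range hTne
  let B : ℕ → Set X := fun n => V (f n)
  have hBU : ⋃ n, B n = C \ F := by
    rw [← hTU, hf]; simp [B]
  have hBcl : ∀ n, IsClopen (B n) := fun n => hV _
  let G : ℕ → Set X := disjointed B
  have hGcl : ∀ n, IsClopen (G n) := by
    intro n
    exact disjointedRec (p := fun s => IsClopen s) (fun _ _ ht => ht.diff (hBcl _)) (hBcl n)
  have hGU : ⋃ n, G n = C \ F := by rw [← hBU]; exact iUnion_disjointed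
  have hGd : Pairwise (Function.onFun Disjoint G) := disjoint_disjointed B
  have hGB : ∀ n, G n ⊆ B n := fun n => disjointed_subset B n
  let N : Set ℕ := {n | (G n).Nonempty}
  have hN : N.Infinite := by
    intro hfin
    apply hnc
    have : C \ F = ⋃ n ∈ N, G n := by
      rw [← hGU]
      ext x
      simp only [Set.mem_iUnion, N, Set.mem_setOf_eq, exists_prop]
      exact ⟨fun ⟨i, hi⟩ => ⟨i, ⟨x, hi⟩, hi⟩, fun ⟨i, _, hi⟩ => ⟨i, hi⟩⟩
    rw [this]
    exact hfin.isClosed_biUnion (fun n _ => (hGcl n).isClosed)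
  haveI : Infinite N := hN.to_subtype
  obtain ⟨e⟩ : Nonempty (ℕ ≃ N) := inferInstance
  refine ⟨fun i => G (e i), fun i => hGcl _, fun i => (e i).2, ?_, ?_, ?_⟩
  · intro i j x hi hj
    by_contra hij
    have : ((e i : N) : ℕ) ≠ e j := fun h => hij (e.injective (Subtype.ext h))
    exact Set.disjoint_left.1 (hGd this) hi hj
  · rw [← hGU]
    ext x
    simp only [Set.mem_iUnion]
    constructor
    · rintro ⟨i, hi⟩; exact ⟨_, hi⟩
    · rintro ⟨i, hi⟩
      refine ⟨e.symm ⟨i, ⟨x, hi⟩⟩, ?_⟩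
      simpa using hi
  · intro i x hx y hy
    rw [hVc _ x (hGB _ hx), hVc _ y (hGB _ hy)]

/-- The state along a branch. -/
def ccpK {X : Type} (step : ℕ → Set X → ℕ → Set X) (a : ℕ → ℕ) : ℕ → Set X
  | 0 => Set.univ
  | n + 1 => step n (ccpK step a n) (a n)

open Classical in
/-- The state along a point. -/
noncomputable def ccpS {X : Type} (step : ℕ → Set X → ℕ → Set X) (x : X) : ℕ → Set X
  | 0 => Set.univ
  | n + 1 => step n (ccpS step x n)
      (if h : ∃ i, x ∈ step n (ccpS step x n) i then h.choose else 0)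

open Classical in
/-- The code of a point. -/
noncomputable def ccpI {X : Type} (step : ℕ → Set X → ℕ → Set X) (x : X) (n : ℕ) : ℕ :=
  if h : ∃ i, x ∈ step n (ccpS step x n) i then h.choose else 0

theorem ccpS_eq {X : Type} (step : ℕ → Set X → ℕ → Set X) (x : X) (n : ℕ) :
    ccpS step x n = ccpK step (ccpI step x) n := by
  induction n with
  | zero => rfl
  | succ n ih =>
    rw [ccpK, ← ih, ccpS, ccpI]

theorem ccpI_spec {X : Type} (step : ℕ → Set X → ℕ → Set X) (x : X) (n : ℕ)
    (h : ∃ i, x ∈ step n (ccpK step (ccpI step x) n) i) :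
    x ∈ step n (ccpK step (ccpI step x) n) (ccpI step x n) := by
  rw [← ccpS_eq] at h ⊢
  rw [ccpI, dif_pos h]
  exact h.choose_spec

theorem ccpK_congr {X : Type} (step : ℕ → Set X → ℕ → Set X) (a b : ℕ → ℕ) (n : ℕ)
    (h : ∀ m < n, a m = b m) : ccpK step a n = ccpK step b n := by
  induction n with
  | zero => rfl
  | succ n ih =>
    rw [ccpK, ccpK, ih (fun m hm => h m (by omega)), h n (by omega)]

theorem ccp_main {X : Type} [TopologicalSpace X] [CompactSpace X] [T2Space X] [Nonempty X]
    [SecondCountableTopology X] [TotallyDisconnectedSpace X]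
    (c : ℕ → X → Bool) (hc : ∀ n, Continuous (c n))
    (hsep : ∀ x y, (∀ n, c n x = c n y) → x = y)
    (E : ℕ → Set X) (hmono : Monotone E) (hE : ∀ n, IsClosed (E n))
    (hEi : ∀ n, interior (E n) = ∅) (hd : Dense (⋃ n, E n)) :
    ∃ g : X → (ℕ → ℕ), ContinuousOn g (⋃ n, E n)ᶜ ∧ Set.InjOn g (⋃ n, E n)ᶜ ∧
      ∀ a, ∃ x ∈ (⋃ n, E n)ᶜ, g x = a := by
  have key : ∀ (n : ℕ) (C : Set X), ∃ A : ℕ → Set X, (IsClopen C ∧ C.Nonempty) →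
      (∀ i, IsClopen (A i)) ∧ (∀ i, (A i).Nonempty) ∧
      (∀ i j, ∀ x, x ∈ A i → x ∈ A j → i = j) ∧ (∃ k, n ≤ k ∧ ⋃ i, A i = C \ E k) ∧
      (∀ i, ∀ x ∈ A i, ∀ y ∈ A i, c n x = c n y) := by
    intro n C
    by_cases h : IsClopen C ∧ C.Nonempty
    · obtain ⟨x, hxC, hx⟩ := hd.inter_open_nonempty C h.1.isOpen h.2
      obtain ⟨k, hk⟩ := Set.mem_iUnion.1 hx
      obtain ⟨A, h1, h2, h3, h4, h5⟩ := ccp_split (c n) (hc n) C (E (max n k)) h.1 (hE _) (hEi _)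
        ⟨x, hxC, hmono (le_max_right _ _) hk⟩
      exact ⟨A, fun _ => ⟨h1, h2, h3, ⟨_, le_max_left _ _, h4⟩, h5⟩⟩
    · exact ⟨fun _ => ∅, fun h' => absurd h' h⟩
  choose step hstep using key
  have hK : ∀ a n, IsClopen (ccpK step a n) ∧ (ccpK step a n).Nonempty := by
    intro a n
    induction n with
    | zero => exact ⟨isClopen_univ, Set.univ_nonempty⟩
    | succ n ih =>
      obtain ⟨h1, h2, -⟩ := hstep n _ ih
      exact ⟨h1 _, h2 _⟩
  have hsub : ∀ a n, ccpK step a (n+1) ⊆ ccpK step a n \ E n := by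
    intro a n x hx
    obtain ⟨-, -, -, ⟨k, hk, h4⟩, -⟩ := hstep n _ (hK a n)
    have : x ∈ ⋃ i, step n (ccpK step a n) i := Set.mem_iUnion.2 ⟨a n, hx⟩
    rw [h4] at this
    exact ⟨this.1, fun h => this.2 (hmono hk h)⟩
  have hmem : ∀ x ∈ (⋃ n, E n)ᶜ, ∀ n, x ∈ ccpK step (ccpI step x) n := by
    intro x hx n
    induction n with
    | zero => exact Set.mem_univ _
    | succ n ih =>
      apply ccpI_spec
      obtain ⟨-, -, -, ⟨k, hk, h4⟩, -⟩ := hstep n _ (hK (ccpI step x) n)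
      apply Set.mem_iUnion.1
      rw [h4]
      exact ⟨ih, fun h => hx (Set.mem_iUnion.2 ⟨k, h⟩)⟩
  have huniq : ∀ x a b n, x ∈ ccpK step a n → x ∈ ccpK step b n → ∀ m < n, a m = b m := by
    intro x a b n
    induction n with
    | zero => intro _ _ m hm; omega
    | succ n ih =>
      intro ha hb m hm
      have h := ih (hsub a n ha).1 (hsub b n hb).1
      rcases Nat.lt_succ_iff_lt_or_eq.1 hm with h' | rfl
      · exact h m h'
      · rw [ccpK] at ha hb
        rw [← ccpK_congr step a b m h] at hb
        obtain ⟨-, -, h3, -⟩ := hstep m _ (hK a m)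
        exact h3 _ _ x ha hb
  refine ⟨ccpI step, ?_, ?_, ?_⟩
  · rw [continuousOn_pi]
    intro n x hx
    have hev : ∀ᶠ y in nhdsWithin x (⋃ n, E n)ᶜ, ccpI step y n = ccpI step x n := by
      have h1 : ccpK step (ccpI step x) (n+1) ∈ nhdsWithin x (⋃ n, E n)ᶜ :=
        mem_nhdsWithin_of_mem_nhds ((hK _ _).1.isOpen.mem_nhds (hmem x hx (n+1)))
      filter_upwards [h1, self_mem_nhdsWithin] with y hy hyY
      exact huniq y _ _ (n+1) (hmem y hyY (n+1)) hy n (by omega)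
    exact tendsto_nhds_of_eventually_eq hev
  · intro x hx y hy hxy
    apply hsep
    intro n
    obtain ⟨-, -, -, -, h5⟩ := hstep n _ (hK (ccpI step x) n)
    have hx' := hmem x hx (n+1)
    have hy' := hmem y hy (n+1)
    rw [← hxy] at hy'
    exact h5 _ x hx' y hy'
  · intro a
    have hne : (⋂ n, ccpK step a n).Nonempty :=
      IsCompact.nonempty_iInter_of_sequence_nonempty_isCompact_isClosed _
        (fun n => fun x hx => (hsub a n hx).1) (fun n => (hK a n).2)
        (hK a 0).1.isClosed.isCompact (fun n => (hK a n).1.isClosed)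
    obtain ⟨x, hx⟩ := hne
    rw [Set.mem_iInter] at hx
    have hxY : x ∈ (⋃ n, E n)ᶜ := by
      intro h
      obtain ⟨n, hn⟩ := Set.mem_iUnion.1 h
      exact (hsub a n (hx (n+1))).2 hn
    refine ⟨x, hxY, ?_⟩
    funext n
    exact huniq x _ _ (n+1) (hmem x hxY (n+1)) (hx (n+1)) n (by omega)

/-- If the Cantor space `2^ω` admits a partition into exactly `κ` nonempty closed
sets, where `κ` is uncountable, then the Baire space `ω^ω` admits a partition
into exactly `κ` nonempty compact sets. -/
theorem cantor_closed_partition_to_baire_compact_partition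
    (κ : Cardinal) (hκ : ℵ₀ < κ)
    (h : ∃ P : Set (Set (ℕ → Bool)),
      (∀ s ∈ P, s.Nonempty) ∧
      (∀ s ∈ P, IsClosed s) ∧
      P.PairwiseDisjoint id ∧
      ⋃₀ P = Set.univ ∧
      #P = κ) :
    ∃ Q : Set (Set (ℕ → ℕ)),
      (∀ s ∈ Q, s.Nonempty) ∧
      (∀ s ∈ Q, IsCompact s) ∧
      Q.PairwiseDisjoint id ∧
      ⋃₀ Q = Set.univ ∧
      #Q = κ := by
  obtain ⟨P, hne, hcl, hdis, hU, hcard⟩ := h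
  have hPunc : ¬ P.Countable := by
    intro h
    rw [← Cardinal.le_aleph0_iff_set_countable, hcard] at h
    exact absurd h (not_le.2 hκ)
  let M : Set (ℕ → Bool) → Set (Set (ℕ → Bool)) := fun W => {K ∈ P | (K ∩ W).Nonempty}
  let O : Set (ℕ → Bool) := ⋃ W : {W : Set (ℕ → Bool) // IsOpen W ∧ (M W).Countable}, W.1
  have hOo : IsOpen O := isOpen_iUnion (fun W => W.2.1)
  have hOc : (M O).Countable := by
    obtain ⟨T, hTc, hT⟩ := TopologicalSpace.isOpen_iUnion_countable
      (fun W : {W : Set (ℕ → Bool) // IsOpen W ∧ (M W).Countable} => W.1) (fun W => W.2.1)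
    refine (hTc.biUnion (t := fun W _ => M W.1) (fun W _ => W.2.2)).mono ?_
    rintro K ⟨hK, x, hxK, hx⟩
    have hx' : x ∈ ⋃ i ∈ T, i.1 := by rw [hT]; exact hx
    simp only [Set.mem_iUnion] at hx' ⊢
    obtain ⟨W, hW, hxW⟩ := hx'
    exact ⟨W, hW, hK, x, hxK, hxW⟩
  have hmax : ∀ W, IsOpen W → (M W).Countable → W ⊆ O := fun W h1 h2 x hx =>
    Set.mem_iUnion.2 ⟨⟨W, h1, h2⟩, hx⟩
  let X : Set (ℕ → Bool) := Oᶜ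
  have hXcl : IsClosed X := hOo.isClosed_compl
  haveI : CompactSpace X := isCompact_iff_compactSpace.1 hXcl.isCompact
  haveI : Nonempty X := by
    by_contra hX
    apply hPunc
    refine hOc.mono ?_
    intro K hK
    obtain ⟨x, hx⟩ := hne K hK
    refine ⟨hK, x, hx, ?_⟩
    by_contra hxO
    exact hX ⟨⟨x, hxO⟩⟩
  have hpc : ∀ x : ℕ → Bool, ∃ K ∈ P, x ∈ K := by
    intro x
    have : x ∈ ⋃₀ P := by rw [hU]; trivial
    exact this
  have huniq : ∀ K ∈ P, ∀ L ∈ P, ∀ x, x ∈ K → x ∈ L → K = L := by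
    intro K hK L hL x hxK hxL
    by_contra hKL
    exact Set.disjoint_left.1 (hdis hK hL hKL) hxK hxL
  choose p hpP hp using hpc
  let d : ℕ → X := TopologicalSpace.denseSeq X
  let D : ℕ → Set (ℕ → Bool) := fun n => p (d n)
  let E : ℕ → Set X := fun n => ⋃ i ∈ Set.Iic n, (Subtype.val ⁻¹' D i : Set X)
  have hEmem : ∀ n x, x ∈ E n ↔ ∃ i ≤ n, x.1 ∈ D i := by
    intro n x; simp [E]
  have hEU : ∀ x, x ∈ ⋃ n, E n ↔ ∃ i, x.1 ∈ D i := by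
    intro x
    simp only [Set.mem_iUnion, hEmem]
    exact ⟨fun ⟨_, i, _, h⟩ => ⟨i, h⟩, fun ⟨i, h⟩ => ⟨i, i, le_rfl, h⟩⟩
  obtain ⟨g, hgc, hgi, hgs⟩ := ccp_main (X := X) (fun n x => x.1 n)
    (fun n => (continuous_apply n).comp continuous_subtype_val)
    (fun x y hxy => Subtype.ext (funext hxy)) E
    (by
      intro m n hmn x hx
      rw [hEmem] at hx ⊢
      obtain ⟨i, hi, hx⟩ := hx
      exact ⟨i, hi.trans hmn, hx⟩)
    (fun n => (Set.finite_Iic n).isClosed_biUnion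
      (fun i _ => (hcl _ (hpP _)).preimage continuous_subtype_val))
    (by
      intro n
      by_contra hI
      obtain ⟨x, hx⟩ := Set.nonempty_iff_ne_empty.2 hI
      obtain ⟨W, hW, hWe⟩ := isOpen_induced_iff.1 (isOpen_interior (s := E n))
      have hxW : x.1 ∈ W := by
        have : x ∈ (Subtype.val ⁻¹' W : Set X) := by rw [hWe]; exact hx
        exact this
      refine x.2 (hmax W hW ?_ hxW)
      refine (hOc.union ((Set.finite_Iic n).image D).countable).mono ?_
      rintro K ⟨hK, y, hyK, hyW⟩
      by_cases hy : y ∈ O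
      · exact Or.inl ⟨hK, y, hyK, hy⟩
      · right
        have : (⟨y, hy⟩ : X) ∈ interior (E n) := by rw [← hWe]; exact hyW
        obtain ⟨i, hi, hyD⟩ := (hEmem _ _).1 (interior_subset this)
        exact ⟨i, hi, huniq _ (hpP _) _ hK y hyD hyK⟩)
    (by
      refine (TopologicalSpace.denseRange_denseSeq X).mono ?_
      rintro _ ⟨n, rfl⟩
      rw [hEU]
      exact ⟨n, hp _⟩)
  let R : Set (Set (ℕ → Bool)) := P \ (M O ∪ Set.range D)
  let P' : Set (Set (ℕ → Bool)) := {K ∈ P | (K ∩ X).Nonempty ∧ K ∉ Set.range D}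
  let φ : Set (ℕ → Bool) → Set (ℕ → ℕ) := fun K => g '' (Subtype.val ⁻¹' K)
  have hY : ∀ K ∈ P', (Subtype.val ⁻¹' K : Set X) ⊆ (⋃ n, E n)ᶜ := by
    rintro K ⟨hK, -, hKD⟩ x hx hxE
    obtain ⟨i, hi⟩ := (hEU x).1 hxE
    exact hKD ⟨i, huniq _ (hpP _) _ hK _ hi hx⟩
  have hφ : ∀ K ∈ P', ∀ L ∈ P', ∀ z, z ∈ φ K → z ∈ φ L → K = L := by
    rintro K hK L hL z ⟨x, hx, rfl⟩ ⟨y, hy, hxy⟩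
    have := hgi (hY L hL hy) (hY K hK hx) hxy
    subst this
    exact huniq _ hK.1 _ hL.1 _ hx hy
  have hφn : ∀ K ∈ P', (φ K).Nonempty := by
    rintro K ⟨_, ⟨x, hxK, hxX⟩, _⟩
    exact ⟨_, ⟨x, hxX⟩, hxK, rfl⟩
  refine ⟨φ '' P', ?_, ?_, ?_, ?_, ?_⟩
  · rintro _ ⟨K, hK, rfl⟩
    exact hφn K hK
  · rintro _ ⟨K, hK, rfl⟩
    exact ((hcl K hK.1).preimage continuous_subtype_val).isCompact.image_of_continuousOn
      (hgc.mono (hY K hK))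
  · rintro _ ⟨K, hK, rfl⟩ _ ⟨L, hL, rfl⟩ hKL
    refine Set.disjoint_left.2 ?_
    intro z h1 h2
    exact hKL (by rw [hφ K hK L hL z h1 h2])
  · refine Set.eq_univ_of_forall ?_
    intro a
    obtain ⟨x, hx, rfl⟩ := hgs a
    refine ⟨_, ⟨p x.1, ⟨hpP _, ⟨x.1, hp _, x.2⟩, ?_⟩, rfl⟩, ⟨x, hp _, rfl⟩⟩
    rintro ⟨i, hi⟩
    apply hx
    rw [hEU]
    exact ⟨i, by rw [hi]; exact hp _⟩
  · have hinj : Set.InjOn φ P' := by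
      intro K hK L hL hKL
      obtain ⟨z, hz⟩ := hφn K hK
      exact hφ K hK L hL z hz (hKL ▸ hz)
    have e1 : #(φ '' P') = #P' := Cardinal.mk_image_eq_of_injOn φ P' hinj
    rw [e1, ← hcard]
    apply le_antisymm
    · exact Cardinal.mk_le_mk_of_subset (fun K hK => hK.1)
    · have hcnt : (M O ∪ Set.range D).Countable := hOc.union (Set.countable_range D)
      have hsub : P ⊆ P' ∪ (M O ∪ Set.range D) := by
        intro K hK
        by_cases h1 : K ∈ Set.range D
        · exact Or.inr (Or.inr h1)
        · obtain ⟨x, hx⟩ := hne K hK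
          by_cases h2 : x ∈ O
          · exact Or.inr (Or.inl ⟨hK, x, hx, h2⟩)
          · exact Or.inl ⟨hK, ⟨x, hx, h2⟩, h1⟩
      have hinf : ℵ₀ ≤ #P' := by
        by_contra hlt
        have : P'.Countable := Cardinal.le_aleph0_iff_set_countable.1 (not_le.1 hlt).le
        exact hPunc ((this.union hcnt).mono hsub)
      calc #P ≤ #(P' ∪ (M O ∪ Set.range D) : Set _) := Cardinal.mk_le_mk_of_subset hsub
        _ ≤ #P' + #(M O ∪ Set.range D : Set _) := Cardinal.mk_union_le _ _
        _ ≤ #P' + #P' := by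
          gcongr
          exact (Cardinal.le_aleph0_iff_set_countable.2 hcnt).trans hinf
        _ = #P' := Cardinal.add_eq_self hinf
end

section
/- Let κ be an uncountable cardinal. If the Baire space ω^ω admits a partition into exactly κ nonempty compact sets, then every uncountable Polish space X admits a partition into exactly κ nonempty compact sets. -/
open Cardinal Topology

universe u

def ClosedCov {Y : Type u} [TopologicalSpace Y] (f : Y → ℕ) : Prop :=
  ∃ K : ℕ → Set Y, (∀ j, IsClosed (K j)) ∧ (∀ y, ∃ j, y ∈ K j) ∧
    ∀ j, ∀ y ∈ K j, ∀ z ∈ K j, f y = f z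

lemma closedCov_step {Y : Type u} [MetricSpace Y] [TopologicalSpace.SeparableSpace Y] [Nonempty Y]
    (f : Y → ℕ) (hf : ClosedCov f) (ε : ℝ) (hε : 0 < ε) :
    ∃ g : Y → ℕ, ClosedCov g ∧ (∀ y z, g y = g z → dist y z ≤ 2 * ε) ∧
      ∀ y z, z ∈ closure (g ⁻¹' {g y}) → f z = f y := by
  classical
  obtain ⟨K, hKc, hKu, hKf⟩ := hf
  let L : ℕ → Set Y := fun j => K j.unpair.1 ∩
    Metric.closedBall (TopologicalSpace.denseSeq Y j.unpair.2) ε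
  have hLc : ∀ j, IsClosed (L j) := fun j => (hKc _).inter Metric.isClosed_closedBall
  have hLu : ∀ y, ∃ j, y ∈ L j := by
    intro y
    obtain ⟨a, ha⟩ := hKu y
    obtain ⟨b, hb⟩ := (TopologicalSpace.denseRange_denseSeq Y).exists_dist_lt y hε
    exact ⟨Nat.pair a b, by simpa [L] using ⟨ha, hb.le⟩⟩
  let g : Y → ℕ := fun y => Nat.find (hLu y)
  have hg : ∀ y, y ∈ L (g y) := fun y => Nat.find_spec (hLu y)
  refine ⟨g, ?_, ?_, ?_⟩
  · have hO : ∀ j, IsOpen (⋂ l ∈ Set.Iio j, (L l)ᶜ) := fun j =>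
      (Set.finite_Iio j).isOpen_biInter fun l _ => (hLc l).isOpen_compl
    choose F hF1 hF2 hF3 hF4 using fun j => (hO j).exists_iUnion_isClosed
    refine ⟨fun k => L k.unpair.1 ∩ F k.unpair.1 k.unpair.2,
      fun k => (hLc _).inter (hF1 _ _), ?_, ?_⟩
    · intro y
      have : y ∈ ⋂ l ∈ Set.Iio (g y), (L l)ᶜ := by
        simp only [Set.mem_iInter, Set.mem_Iio]
        intro l hl
        exact Nat.find_min (hLu y) hl
      rw [← hF3] at this
      obtain ⟨m, hm⟩ := Set.mem_iUnion.1 this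
      exact ⟨Nat.pair (g y) m, by simpa using ⟨hg y, hm⟩⟩
    · have key : ∀ k y, y ∈ L (Nat.unpair k).1 ∩ F (Nat.unpair k).1 (Nat.unpair k).2 →
          g y = (Nat.unpair k).1 := by
        intro k y hy
        refine (Nat.find_eq_iff (hLu y)).2 ⟨hy.1, ?_⟩
        have := hF2 _ _ hy.2
        simp only [Set.mem_iInter, Set.mem_Iio] at this
        exact fun l hl => this l hl
      intro k y hy z hz
      rw [key k y hy, key k z hz]
  · intro y z h
    have h1 := (hg y).2
    have h2 := (hg z).2
    rw [← h] at h2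
    rw [Metric.mem_closedBall] at h1 h2
    have := dist_triangle_right y z (TopologicalSpace.denseSeq Y (g y).unpair.2)
    linarith
  · intro y z hz
    have : closure (g ⁻¹' {g y}) ⊆ L (g y) := by
      refine closure_minimal ?_ (hLc _)
      intro w hw
      have := hg w
      rwa [show g w = g y from hw] at this
    exact hKf _ z (this hz).1 y (hg y).1

lemma exists_code (Y : Type u) [TopologicalSpace Y] [PolishSpace Y] [Nonempty Y] :
    ∃ φ : Y → (ℕ → ℕ), ∀ K : Set (ℕ → ℕ), IsCompact K → IsCompact (φ ⁻¹' K) := by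
  letI := TopologicalSpace.upgradeIsCompletelyMetrizable Y
  let S := {f : Y → ℕ // ClosedCov f}
  have h0 : ClosedCov (fun _ : Y => 0) :=
    ⟨fun _ => Set.univ, by simp, by simp, by simp⟩
  have hstep : ∀ (n : ℕ) (f : S), ∃ g : S,
      (∀ y z, g.1 y = g.1 z → dist y z ≤ 2 * (1/2 : ℝ)^n) ∧
      ∀ y z, z ∈ closure (g.1 ⁻¹' {g.1 y}) → f.1 z = f.1 y := by
    intro n f
    obtain ⟨g, h1, h2, h3⟩ := closedCov_step f.1 f.2 ((1/2 : ℝ)^n) (by positivity)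
    exact ⟨⟨g, h1⟩, h2, h3⟩
  choose nxt hn1 hn2 using hstep
  let F : ℕ → S := fun n => Nat.rec ⟨_, h0⟩ (fun n f => nxt n f) n
  have hF1 : ∀ n y z, (F (n+1)).1 y = (F (n+1)).1 z → dist y z ≤ 2 * (1/2 : ℝ)^n :=
    fun n => hn1 n (F n)
  have hF2 : ∀ n y z, z ∈ closure ((F (n+1)).1 ⁻¹' {(F (n+1)).1 y}) → (F n).1 z = (F n).1 y :=
    fun n => hn2 n (F n)
  refine ⟨fun y n => (F n).1 y, fun K hK => ?_⟩
  apply IsSeqCompact.isCompact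
  intro y hy
  obtain ⟨x, hxK, σ, hσ, hlim⟩ := hK.isSeqCompact hy
  have hev : ∀ n, ∃ N, ∀ m ≥ N, (F n).1 (y (σ m)) = x n := by
    intro n
    have := (tendsto_pi_nhds.1 hlim) n
    rw [nhds_discrete, Filter.tendsto_pure] at this
    exact Filter.eventually_atTop.1 this
  have hC : CauchySeq (y ∘ σ) := by
    rw [Metric.cauchySeq_iff]
    intro ε hε
    obtain ⟨n, hn⟩ := exists_pow_lt_of_lt_one (half_pos hε) (by norm_num : (1/2 : ℝ) < 1)
    obtain ⟨N, hN⟩ := hev (n+1)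
    refine ⟨N, fun a ha b hb => ?_⟩
    have := hF1 n (y (σ a)) (y (σ b)) ((hN a ha).trans (hN b hb).symm)
    simp only [Function.comp]
    linarith
  obtain ⟨z, hz⟩ := cauchySeq_tendsto_of_complete hC
  refine ⟨z, ?_, σ, hσ, hz⟩
  have : (fun n => (F n).1 z) = x := by
    funext n
    obtain ⟨N, hN⟩ := hev (n+1)
    obtain ⟨N', hN'⟩ := hev n
    rw [← hN' (max N N') (le_max_right _ _)]
    apply hF2
    refine mem_closure_of_tendsto hz ?_
    filter_upwards [Filter.eventually_ge_atTop N] with m hm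
    exact (hN m hm).trans (hN _ (le_max_left _ _)).symm
  change (fun n => (F n).1 z) ∈ K
  rwa [this]

lemma isCompact_of_finer {X : Type u} (t' t : TopologicalSpace X) (h : t' ≤ t) (s : Set X)
    (hs : @IsCompact X t' s) : @IsCompact X t s := by
  have h2 := @IsCompact.image X X t' t s id hs (continuous_id_of_le h)
  rwa [Set.image_id] at h2

lemma exists_inj (X : Type u) [TopologicalSpace X] [PolishSpace X] [Uncountable X] :
    ∃ j : (ℕ → ℕ) → X, Continuous j ∧ Function.Injective j := by
  obtain ⟨f, -, hf, hi⟩ := (isClosed_univ (X := X)).exists_nat_bool_injection_of_not_countable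
    (Set.not_countable_univ)
  refine ⟨fun x => f fun k => decide (x k.unpair.1 = k.unpair.2), ?_, ?_⟩
  · refine hf.comp (continuous_pi fun k => ?_)
    exact (continuous_of_discreteTopology (f := fun a : ℕ => decide (a = k.unpair.2))).comp
      (continuous_apply k.unpair.1)
  · intro x y h
    have h := hi h
    funext n
    have := congrFun h (Nat.pair n (y n))
    simpa using this

/-- If the Baire space `ω^ω` admits a partition into exactly `κ` nonempty compact
sets, where `κ` is uncountable, then every uncountable Polish space `X` admits a
partition into exactly `κ` nonempty compact sets. -/
theorem baire_compact_partition_to_all_polish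
    (κ : Cardinal.{0}) (hκ : ℵ₀ < κ)
    (h : ∃ P : Set (Set (ℕ → ℕ)),
      (∀ s ∈ P, s.Nonempty) ∧
      (∀ s ∈ P, IsCompact s) ∧
      P.PairwiseDisjoint id ∧
      ⋃₀ P = Set.univ ∧
      #P = κ)
    (X : Type u) [TopologicalSpace X] [PolishSpace X] [Uncountable X] :
    ∃ Q : Set (Set X),
      (∀ s ∈ Q, s.Nonempty) ∧
      (∀ s ∈ Q, IsCompact s) ∧
      Q.PairwiseDisjoint id ∧
      ⋃₀ Q = Set.univ ∧
      #Q = Cardinal.lift.{u} κ := by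
  obtain ⟨P, hne, hc, hd, hu, hcard⟩ := h
  obtain ⟨j, hj, hji⟩ := exists_inj X
  have hB : ∃ φ : X → (ℕ → ℕ), ∀ K : Set (ℕ → ℕ), IsCompact K →
      IsCompact (φ ⁻¹' K ∩ (Set.range j)ᶜ) := by
    letI : MeasurableSpace X := borel X
    haveI : BorelSpace X := ⟨rfl⟩
    have hm : MeasurableSet (Set.range j) :=
      (hj.measurableEmbedding hji).measurableSet_range
    obtain ⟨t', ht', hp, -, ho⟩ := hm.isClopenable
    obtain ⟨φ, hφ⟩ := @exists_code X t' hp inferInstance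
    refine ⟨φ, fun K hK => ?_⟩
    have h1 : @IsCompact X t' (φ ⁻¹' K ∩ (Set.range j)ᶜ) :=
      @IsCompact.inter_right X t' _ _ (hφ K hK) (@IsOpen.isClosed_compl X t' _ ho)
    exact isCompact_of_finer t' _ ht' _ h1
  obtain ⟨φ, hφ⟩ := hB
  have hex : ∀ x, ∃ s ∈ P, x ∈ s := fun x => by
    have : x ∈ ⋃₀ P := hu ▸ Set.mem_univ x
    simpa using this
  have huniq : ∀ s ∈ P, ∀ t ∈ P, ∀ x, x ∈ s → x ∈ t → s = t := fun s hs t ht x h1 h2 =>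
    hd.elim hs ht (Set.not_disjoint_iff.2 ⟨x, h1, h2⟩)
  let Q1 : Set (Set X) := (fun s => j '' s) '' P
  let Q2 : Set (Set X) := (fun s => φ ⁻¹' s ∩ (Set.range j)ᶜ) '' P
  have hQ1 : #Q1 = Cardinal.lift.{u} κ := by
    have := Cardinal.mk_image_eq_lift (fun s => j '' s) P hji.image_injective
    simpa [hcard] using this
  have hQ2 : #Q2 ≤ Cardinal.lift.{u} κ := by
    have := Cardinal.mk_image_le_lift (f := fun s => φ ⁻¹' s ∩ (Set.range j)ᶜ) (s := P)
    simpa [hcard] using this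
  refine ⟨Q1 ∪ (Q2 \ {∅}), ?_, ?_, ?_, ?_, ?_⟩
  · rintro _ (⟨s, hs, rfl⟩ | ⟨-, hs⟩)
    · exact (hne s hs).image j
    · exact Set.nonempty_iff_ne_empty.2 hs
  · rintro _ (⟨s, hs, rfl⟩ | ⟨⟨s, hs, rfl⟩, -⟩)
    · exact (hc s hs).image hj
    · exact hφ s (hc s hs)
  · intro a ha b hb hab
    by_contra hnd
    obtain ⟨x, hxa, hxb⟩ := Set.not_disjoint_iff.1 hnd
    apply hab
    rcases ha with ⟨s, hs, rfl⟩ | ⟨⟨s, hs, rfl⟩, -⟩ <;>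
      rcases hb with ⟨t, ht, rfl⟩ | ⟨⟨t, ht, rfl⟩, -⟩
    · obtain ⟨p, hp, rfl⟩ := hxa
      obtain ⟨q, hq, hpq⟩ := hxb
      rw [hji hpq] at hq
      rw [huniq s hs t ht p hp hq]
    · obtain ⟨p, hp, rfl⟩ := hxa
      exact (hxb.2 ⟨p, rfl⟩).elim
    · obtain ⟨p, hp, rfl⟩ := hxb
      exact (hxa.2 ⟨p, rfl⟩).elim
    · rw [huniq s hs t ht (φ x) hxa.1 hxb.1]
  · refine Set.eq_univ_of_forall fun x => ?_
    by_cases hx : x ∈ Set.range j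
    · obtain ⟨p, rfl⟩ := hx
      obtain ⟨s, hs, hp⟩ := hex p
      exact ⟨j '' s, Or.inl ⟨s, hs, rfl⟩, p, hp, rfl⟩
    · obtain ⟨s, hs, hp⟩ := hex (φ x)
      have hm : x ∈ φ ⁻¹' s ∩ (Set.range j)ᶜ := ⟨hp, hx⟩
      exact ⟨_, Or.inr ⟨⟨s, hs, rfl⟩, Set.nonempty_iff_ne_empty.1 ⟨x, hm⟩⟩, hm⟩
  · apply le_antisymm
    · have hinf : ℵ₀ ≤ Cardinal.lift.{u} κ := by simpa using hκ.le
      calc #(Q1 ∪ (Q2 \ {∅}) : Set (Set X)) ≤ #Q1 + #(Q2 \ {∅} : Set (Set X)) :=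
            Cardinal.mk_union_le _ _
        _ ≤ Cardinal.lift.{u} κ + Cardinal.lift.{u} κ :=
            add_le_add hQ1.le ((Cardinal.mk_le_mk_of_subset Set.sdiff_subset).trans hQ2)
        _ = _ := Cardinal.add_eq_self hinf
    · rw [← hQ1]
      exact Cardinal.mk_le_mk_of_subset Set.subset_union_left
end

section
/- Let κ be an uncountable cardinal. If some uncountable compact Polish space X admits a partition into exactly κ nonempty F_σ sets, then the Cantor space 2^ω admits a partition into exactly κ nonempty closed sets. -/
open Cardinal

universe u

/-- A set is `Fσ` if it is a countable union of closed sets. -/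
def IsFsigma {X : Type*} [TopologicalSpace X] (s : Set X) : Prop :=
  ∃ F : ℕ → Set X, (∀ n, IsClosed (F n)) ∧ s = ⋃ n, F n

theorem open_disj_clopen (U : Set (ℕ → Bool)) (hU : IsOpen U) :
    ∃ C : ℕ → Set (ℕ → Bool), (∀ n, IsClosed (C n)) ∧ Pairwise (Function.onFun Disjoint C) ∧
      U = ⋃ n, C n := by
  obtain ⟨S, hS, rfl⟩ :=
    (isTopologicalBasis_isClopen (X := ℕ → Bool)).open_eq_sUnion hU
  obtain ⟨T, hT, hTS, hTU⟩ :=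
    TopologicalSpace.isOpen_sUnion_countable S (fun s hs => (hS hs).isOpen)
  obtain ⟨f, hf⟩ := (hT.insert ∅).exists_eq_range (Set.insert_nonempty _ _)
  have hcl : ∀ n, IsClopen (f n) := by
    intro n
    have : f n ∈ insert ∅ T := hf ▸ Set.mem_range_self n
    rcases this with h | h
    · rw [h]; exact isClopen_empty
    · exact hS (hTS h)
  refine ⟨disjointed f, fun n => ?_, disjoint_disjointed f, ?_⟩
  · exact (disjointedRec (p := IsClopen) (fun t i ht => ht.diff (hcl i)) (hcl n)).isClosed
  · rw [iUnion_disjointed, ← hTU, ← Set.sUnion_range, ← hf]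
    simp

theorem fsigma_disj (s : Set (ℕ → Bool)) (hs : IsFsigma s) :
    ∃ G : ℕ × ℕ → Set (ℕ → Bool), (∀ n, IsClosed (G n)) ∧
      Pairwise (Function.onFun Disjoint G) ∧ s = ⋃ n, G n := by
  obtain ⟨F, hF, rfl⟩ := hs
  have hop : ∀ n : ℕ, IsOpen (⋂ j < n, (F j)ᶜ) := fun n =>
    (Set.finite_lt_nat n).isOpen_biInter (fun j _ => (hF j).isOpen_compl)
  choose C hC hd hU using fun n => open_disj_clopen _ (hop n)
  have hdF : ∀ n, disjointed F n = ⋃ k, F n ∩ C n k := by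
    intro n
    rw [disjointed_eq_inter_compl, hU n, Set.inter_iUnion]
  refine ⟨fun p => F p.1 ∩ C p.1 p.2, fun p => (hF _).inter (hC _ _), ?_, ?_⟩
  · rintro ⟨n, k⟩ ⟨m, l⟩ hne
    by_cases hnm : n = m
    · subst hnm
      have hkl : k ≠ l := fun h => hne (by rw [h])
      exact (hd n hkl).mono Set.inter_subset_right Set.inter_subset_right
    · refine (disjoint_disjointed F hnm).mono ?_ ?_
      · rw [hdF]; exact Set.subset_iUnion (fun k => F n ∩ C n k) k
      · rw [hdF]; exact Set.subset_iUnion (fun k => F m ∩ C m k) l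
  · rw [← iUnion_disjointed, Set.iUnion_prod']
    exact Set.iUnion_congr hdF

/-- If some uncountable compact Polish space `X` admits a partition into exactly
`κ` nonempty `Fσ` sets, where `κ` is uncountable, then the Cantor space `2^ω`
admits a partition into exactly `κ` nonempty closed sets. -/
theorem compact_polish_fsigma_partition_to_cantor_closed
    (κ : Cardinal.{0}) (hκ : ℵ₀ < κ)
    (X : Type u) [TopologicalSpace X] [PolishSpace X] [CompactSpace X] [Uncountable X]
    (h : ∃ P : Set (Set X),
      (∀ s ∈ P, s.Nonempty) ∧
      (∀ s ∈ P, IsFsigma s) ∧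
      P.PairwiseDisjoint id ∧
      ⋃₀ P = Set.univ ∧
      #P = Cardinal.lift.{u} κ) :
    ∃ Q : Set (Set (ℕ → Bool)),
      (∀ s ∈ Q, s.Nonempty) ∧
      (∀ s ∈ Q, IsClosed s) ∧
      Q.PairwiseDisjoint id ∧
      ⋃₀ Q = Set.univ ∧
      #Q = κ := by
  obtain ⟨P, hne, hFs, hdis, hcov, hcard⟩ := h
  let _ := TopologicalSpace.upgradeIsCompletelyMetrizable X
  obtain ⟨f, hfc, hfs⟩ := exists_nat_bool_continuous_surjective_of_compact X
  have hpre : ∀ p : P, IsFsigma (f ⁻¹' (p : Set X)) := by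
    intro p
    obtain ⟨F, hF, h⟩ := hFs p p.2
    exact ⟨fun n => f ⁻¹' F n, fun n => (hF n).preimage hfc, by rw [h, Set.preimage_iUnion]⟩
  choose G hGc hGd hGU using fun p : P => fsigma_disj (f ⁻¹' (p : Set X)) (hpre p)
  have hsub : ∀ p i, G p i ⊆ f ⁻¹' (p : Set X) := fun p i => by
    rw [hGU p]; exact Set.subset_iUnion _ i
  have hPd : ∀ p q : P, p ≠ q → Disjoint (f ⁻¹' (p : Set X)) (f ⁻¹' (q : Set X)) := by
    intro p q hpq
    exact (hdis p.2 q.2 (fun h => hpq (Subtype.ext h))).preimage f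
  have hex : ∀ p : P, ∃ i, (G p i).Nonempty := by
    intro p
    obtain ⟨x, hx⟩ := hne p p.2
    obtain ⟨y, rfl⟩ := hfs x
    have : y ∈ ⋃ n, G p n := by rw [← hGU p]; exact hx
    obtain ⟨i, hi⟩ := Set.mem_iUnion.1 this
    exact ⟨i, y, hi⟩
  refine ⟨{s | s.Nonempty ∧ s ∈ Set.range (fun a : P × (ℕ × ℕ) => G a.1 a.2)},
    fun s hs => hs.1, ?_, ?_, ?_, ?_⟩
  · rintro s ⟨-, a, rfl⟩
    exact hGc _ _
  · rintro s ⟨-, ⟨p, i⟩, rfl⟩ t ⟨-, ⟨q, j⟩, rfl⟩ hst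
    by_cases hpq : p = q
    · subst hpq
      exact hGd p (fun h => hst (congrArg (G p) h))
    · exact (hPd p q hpq).mono (hsub p i) (hsub q j)
  · refine Set.eq_univ_of_forall fun y => ?_
    have : f y ∈ ⋃₀ P := hcov ▸ Set.mem_univ _
    obtain ⟨p, hp, hy⟩ := this
    have : y ∈ ⋃ n, G ⟨p, hp⟩ n := by rw [← hGU ⟨p, hp⟩]; exact hy
    obtain ⟨i, hi⟩ := Set.mem_iUnion.1 this
    exact ⟨_, ⟨⟨y, hi⟩, ⟨(⟨p, hp⟩, i), rfl⟩⟩, hi⟩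
  · apply Cardinal.lift_injective.{u}
    apply le_antisymm
    · have h1 := Cardinal.mk_range_le_lift (f := fun a : P × (ℕ × ℕ) => G a.1 a.2)
      have h2 : #(P × (ℕ × ℕ)) = Cardinal.lift.{u} κ := by
        rw [Cardinal.mk_prod, hcard]
        simp only [Cardinal.mk_denumerable, Cardinal.lift_aleph0, Cardinal.lift_uzero,
          Cardinal.lift_id]
        apply Cardinal.mul_eq_left <;> simp [hκ.le, Cardinal.aleph0_ne_zero]
      rw [h2] at h1
      refine (Cardinal.lift_le.2 (Cardinal.mk_le_mk_of_subset fun s hs => hs.2)).trans ?_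
      simpa using h1
    · rw [← hcard]
      choose i hi using hex
      have hinj : Function.Injective (fun p : P =>
          (⟨G p (i p), hi p, ⟨(p, i p), rfl⟩⟩ :
            {s | s.Nonempty ∧ s ∈ Set.range (fun a : P × (ℕ × ℕ) => G a.1 a.2)})) := by
        intro p q h
        by_contra hpq
        have h' : G p (i p) = G q (i q) := congrArg Subtype.val h
        obtain ⟨y, hy⟩ := hi p
        exact Set.disjoint_left.1 (hPd p q hpq) (hsub _ _ hy) (hsub _ _ (h' ▸ hy))
      have h3 := Cardinal.lift_mk_le_lift_mk_of_injective hinj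
      rwa [Cardinal.lift_uzero] at h3
end

section
/- Let S be the set of all cardinals μ such that the Cantor space 2^ω admits a partition into exactly μ nonempty closed sets. Then S is closed under singular limits: for every singular cardinal κ, if S ∩ κ is unbounded in κ (i.e., for every cardinal λ < κ there is μ ∈ S with λ ≤ μ < κ), then κ ∈ S. -/
open Cardinal

/-- The set of cardinals `μ` such that the Cantor space `2^ω` admits a partition
into exactly `μ` nonempty closed sets. -/
def cantorClosedPartitionSpectrum : Set Cardinal :=
  {μ | ∃ P : Set (Set (ℕ → Bool)),
    (∀ s ∈ P, s.Nonempty) ∧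
    (∀ s ∈ P, IsClosed s) ∧
    P.PairwiseDisjoint id ∧
    ⋃₀ P = Set.univ ∧
    #P = μ}

/-- The set of sizes of partitions of the Cantor space into closed sets is closed
under singular limits: if `κ` is singular (infinite with `cof κ.ord < κ`) and the
spectrum is unbounded in `κ`, then `κ` belongs to the spectrum. -/
theorem cantorClosedPartitionSpectrum_closed_under_singular_limits
    (κ : Cardinal) (hinf : ℵ₀ ≤ κ) (hsing : κ.ord.cof < κ)
    (hub : ∀ l : Cardinal, l < κ →
      ∃ μ ∈ cantorClosedPartitionSpectrum, l ≤ μ ∧ μ < κ) :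
    κ ∈ cantorClosedPartitionSpectrum := by
  classical
  -- a cofinal set of size `cof κ`
  obtain ⟨s, hs, hscard⟩ := Order.exists_cof_eq (α := κ.ord.ToType)
  rw [Ordinal.cof_toType] at hscard
  obtain ⟨μ, ⟨P, hPne, hPcl, hPd, hPu, hPc⟩, hμ1, hμ2⟩ := hub _ hsing
  have hsP : #s ≤ #P := by rw [hscard, hPc]; exact hμ1
  have hl : ∀ a : κ.ord.ToType, (Ordinal.typein (α := κ.ord.ToType) (· < ·) a).card < κ := by
    intro a
    rw [← Cardinal.lt_ord]
    simpa using Ordinal.typein_lt_type (α := κ.ord.ToType) (· < ·) a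
  have hone : ∀ o < κ.ord, ∃ a : κ.ord.ToType,
      Ordinal.typein (α := κ.ord.ToType) (· < ·) a = o := by
    intro o ho
    exact Ordinal.typein_surj (α := κ.ord.ToType) (· < ·) (by simpa using ho)
  have hκ0 : 0 < κ := lt_of_lt_of_le aleph0_pos hinf
  have hsne : Nonempty s := by
    obtain ⟨a, -⟩ := hone 0 (by rw [Cardinal.lt_ord]; simpa using hκ0)
    obtain ⟨b, hb, -⟩ := hs a
    exact ⟨⟨b, hb⟩⟩
  obtain ⟨e⟩ := hsP
  have hsurj : Function.Surjective (Function.invFun e) := Function.invFun_surjective e.injective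
  generalize Function.invFun e = h at hsurj
  have hQ : ∀ p : P, ∃ Q : Set (Set (ℕ → Bool)),
      (∀ s ∈ Q, s.Nonempty) ∧ (∀ s ∈ Q, IsClosed s) ∧ Q.PairwiseDisjoint id ∧
      ⋃₀ Q = Set.univ ∧
      (Ordinal.typein (α := κ.ord.ToType) (· < ·) (h p).1).card ≤ #Q ∧ #Q < κ := by
    intro p
    obtain ⟨ν, ⟨Q, h1, h2, h3, h4, h5⟩, h6, h7⟩ := hub _ (hl (h p).1)
    exact ⟨Q, h1, h2, h3, h4, h5 ▸ h6, h5 ▸ h7⟩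
  choose Q hQne hQcl hQd hQu hQl hQκ using hQ
  let f : (ℕ → Bool) → (ℕ → Bool) := fun x n => x (2 * n)
  let g : (ℕ → Bool) → (ℕ → Bool) := fun x n => x (2 * n + 1)
  have hf : Continuous f := by fun_prop
  have hg : Continuous g := by fun_prop
  have hfg : ∀ y z, ∃ x, f x = y ∧ g x = z := by
    intro y z
    refine ⟨fun n => if n % 2 = 0 then y (n / 2) else z (n / 2), ?_, ?_⟩
    · funext n; simp [f]
    · funext n
      have h1 : (2 * n + 1) % 2 = 1 := by omega
      have h2 : (2 * n + 1) / 2 = n := by omega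
      simp [g, h1, h2]
  let F : (Σ p : P, Q p) → Set (ℕ → Bool) := fun t => f ⁻¹' t.1.1 ∩ g ⁻¹' t.2.1
  have hFne : ∀ t, (F t).Nonempty := by
    rintro ⟨⟨C, hC⟩, ⟨D, hD⟩⟩
    obtain ⟨y, hy⟩ := hPne C hC
    obtain ⟨z, hz⟩ := hQne _ D hD
    obtain ⟨x, rfl, rfl⟩ := hfg y z
    exact ⟨x, hy, hz⟩
  have hFeq : ∀ t t' x, x ∈ F t → x ∈ F t' → t = t' := by
    rintro ⟨⟨C, hC⟩, ⟨D, hD⟩⟩ ⟨⟨C', hC'⟩, ⟨D', hD'⟩⟩ x ⟨h1, h2⟩ ⟨h3, h4⟩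
    have hCC : C = C' := hPd.elim_set hC hC' (f x) h1 h3
    subst hCC
    have hDD : D = D' := (hQd _).elim_set hD hD' (g x) h2 h4
    subst hDD
    rfl
  have hFinj : Function.Injective F := by
    intro t t' htt
    obtain ⟨x, hx⟩ := hFne t
    exact hFeq t t' x hx (htt ▸ hx)
  refine ⟨Set.range F, ?_, ?_, ?_, ?_, ?_⟩
  · rintro _ ⟨t, rfl⟩; exact hFne t
  · rintro _ ⟨t, rfl⟩
    exact ((hPcl _ t.1.2).preimage hf).inter ((hQcl _ _ t.2.2).preimage hg)
  · rintro _ ⟨t, rfl⟩ _ ⟨t', rfl⟩ hne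
    refine Set.disjoint_left.2 fun x hx hx' => hne ?_
    rw [hFeq t t' x hx hx']
  · refine Set.eq_univ_of_forall fun x => ?_
    obtain ⟨C, hC, hxC⟩ : f x ∈ ⋃₀ P := hPu ▸ Set.mem_univ _
    obtain ⟨D, hD, hxD⟩ : g x ∈ ⋃₀ (Q ⟨C, hC⟩) := hQu ⟨C, hC⟩ ▸ Set.mem_univ _
    exact ⟨_, ⟨⟨⟨C, hC⟩, ⟨D, hD⟩⟩, rfl⟩, hxC, hxD⟩
  · rw [Cardinal.mk_range_eq F hFinj, Cardinal.mk_sigma]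
    apply le_antisymm
    · calc Cardinal.sum (fun p : P => #(Q p)) ≤ Cardinal.sum (fun _ : P => κ) :=
            Cardinal.sum_le_sum _ _ fun p => (hQκ p).le
        _ = #P * κ := by simp
        _ ≤ κ * κ := by rw [hPc]; exact mul_le_mul_left hμ2.le κ
        _ = κ := Cardinal.mul_eq_self hinf
    · by_contra hlt
      rw [not_le] at hlt
      set c := Cardinal.sum (fun p : P => #(Q p)) with hc
      have hsucc : Order.succ c < κ := by
        refine lt_of_le_of_ne (Order.succ_le_of_lt hlt) fun heq => ?_
        have hc0 : ℵ₀ ≤ c := by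
          by_contra hcn
          rw [not_le] at hcn
          have := Cardinal.isSuccLimit_aleph0.succ_lt hcn
          rw [heq] at this
          exact absurd hinf (not_le.2 this)
        have := (Cardinal.isRegular_succ hc0).cof_ord
        rw [heq] at this
        exact hsing.ne this
      obtain ⟨a, ha⟩ := hone (Order.succ c).ord (Cardinal.ord_lt_ord.2 hsucc)
      obtain ⟨b, hb, hab⟩ := hs a
      obtain ⟨p, hp⟩ := hsurj ⟨b, hb⟩
      have h1 : Order.succ c ≤ #(Q p) := by
        refine le_trans ?_ (hQl p)
        rw [hp]
        have : (Order.succ c).ord ≤ Ordinal.typein (α := κ.ord.ToType) (· < ·) b := by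
          rw [← ha]
          exact (Ordinal.typein_le_typein (α := κ.ord.ToType) (· < ·)).2 (not_lt.2 hab)
        exact Cardinal.ord_le.1 this
      have h2 : #(Q p) ≤ c := Cardinal.le_sum (fun p : P => #(Q p)) p
      exact absurd (h1.trans h2) (not_le.2 (Order.lt_succ c))
end

section
/- Let κ be an uncountable cardinal. If some uncountable Polish space admits a partition into exactly κ nonempty F_σ sets, then every uncountable Polish space admits a partition into exactly κ nonempty compact sets. (Consequently, the six statements 'some/every uncountable Polish space can be partitioned into κ compact/closed/F_σ sets' are all equivalent.) -/
open Cardinal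

universe u

open scoped Topology

lemma clopen_cyl (R : Set (ℕ → ℕ) → Prop) (k : ℕ) :
    IsClosed {x : ℕ → ℕ | R (PiNat.cylinder x k)} := by
  rw [← isOpen_compl_iff, isOpen_iff_mem_nhds]
  intro x hx
  filter_upwards [(PiNat.isOpen_cylinder (fun _ : ℕ => ℕ) x k).mem_nhds
        (PiNat.self_mem_cylinder _ _)] with y hy
  have := PiNat.mem_cylinder_iff_eq.1 hy
  simp only [Set.mem_compl_iff, Set.mem_ofPred_eq] at hx ⊢
  rwa [this]

lemma L1 {I : Type u} (p : (ℕ → ℕ) → I) (hp : ∀ i, IsFsigma (p ⁻¹' {i})) :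
    ∃ r : (ℕ → ℕ) → ℕ × ℕ, ∀ j : I × ℕ × ℕ, IsClosed ((fun x => (p x, r x)) ⁻¹' {j}) := by
  classical
  choose E hE hpE using hp
  have h1 : ∀ x, ∃ n, x ∈ E (p x) n := by
    intro x
    have : x ∈ p ⁻¹' {p x} := rfl
    rw [hpE] at this
    simpa using this
  let A : I → ℕ → Set (ℕ → ℕ) := fun i n => ⋃ m ∈ Finset.range n, E i m
  have hA : ∀ i n, IsClosed (A i n) := fun i n => isClosed_biUnion_finset (fun m _ => hE i m)
  have h2 : ∀ x, ∃ k, PiNat.cylinder x k ∩ A (p x) (Nat.find (h1 x)) = ∅ := by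
    intro x
    have hx : x ∈ (A (p x) (Nat.find (h1 x)))ᶜ := by
      simp only [A, Set.mem_compl_iff, Set.mem_iUnion, not_exists, Finset.mem_range]
      intro m hm
      exact Nat.find_min (h1 x) hm
    obtain ⟨_, ⟨w, k, rfl⟩, hxk, hsub⟩ :=
      (PiNat.isTopologicalBasis_cylinders (fun _ : ℕ => ℕ)).exists_subset_of_mem_open
        hx (hA _ _).isOpen_compl
    rw [← PiNat.mem_cylinder_iff_eq.1 hxk] at hsub
    exact ⟨k, Set.disjoint_iff_inter_eq_empty.1 (Set.disjoint_left.2 fun y hy => hsub hy)⟩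
  refine ⟨fun x => (Nat.find (h1 x), Nat.find (h2 x)), ?_⟩
  rintro ⟨i, n, k⟩
  have : (fun x => (p x, (Nat.find (h1 x), Nat.find (h2 x)))) ⁻¹' {(i, n, k)} =
      E i n ∩ {x | (fun C => C ∩ A i n = ∅) (PiNat.cylinder x k)} ∩
        ⋂ l ∈ Finset.range k, {x | (fun C => ¬ (C ∩ A i n = ∅)) (PiNat.cylinder x l)} := by
    ext x
    simp only [Set.mem_preimage, Set.mem_singleton_iff, Prod.mk.injEq, Set.mem_inter_iff,
      Set.mem_ofPred_eq, Set.mem_iInter, Finset.mem_range]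
    constructor
    · rintro ⟨rfl, rfl, rfl⟩
      exact ⟨⟨Nat.find_spec (h1 x), Nat.find_spec (h2 x)⟩,
        fun l hl => Nat.find_min (h2 x) hl⟩
    · rintro ⟨⟨hx, hk⟩, hl⟩
      have hpx : p x = i := by
        have : x ∈ p ⁻¹' {i} := by rw [hpE]; exact Set.mem_iUnion.2 ⟨n, hx⟩
        exact this
      subst hpx
      have hn : Nat.find (h1 x) = n := by
        rw [Nat.find_eq_iff]
        refine ⟨hx, fun m hm hxm => ?_⟩
        have : x ∈ PiNat.cylinder x k ∩ A (p x) n :=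
          ⟨PiNat.self_mem_cylinder _ _, by
            simp only [A, Set.mem_iUnion, Finset.mem_range]; exact ⟨m, hm, hxm⟩⟩
        rw [hk] at this
        exact this
      refine ⟨rfl, hn, ?_⟩
      rw [Nat.find_eq_iff, hn]
      exact ⟨hk, hl⟩
  rw [this]
  exact ((hE i n).inter (clopen_cyl (fun C => C ∩ A i n = ∅) k)).inter
    (isClosed_biInter fun l _ => clopen_cyl (fun C => ¬ (C ∩ A i n = ∅)) l)

lemma L3a (Y : Type u) (t : TopologicalSpace Y) (ht : @PolishSpace Y t) :
    ∃ a : Y → ℕ → ℕ, (∃ t' ≤ t, @PolishSpace Y t' ∧ @Continuous Y (ℕ → ℕ) t' _ a) ∧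
      ∀ (b : ℕ → ℕ) (F : Ultrafilter Y), {y | ∀ n, a y n ≤ b n} ∈ F →
        ∃ y, (F : Filter Y) ≤ @nhds Y t y := by
  classical
  rcases isEmpty_or_nonempty Y with hY | hY
  · refine ⟨fun _ _ => 0, ⟨t, le_rfl, ht, continuous_const⟩, fun b F hF => ?_⟩
    obtain ⟨y, -⟩ := F.nonempty_of_mem hF
    exact hY.elim y
  let := TopologicalSpace.upgradeIsCompletelyMetrizable Y
  let : MeasurableSpace Y := borel Y
  have : BorelSpace Y := ⟨rfl⟩
  have h1 : ∀ (n : ℕ) (y : Y), ∃ k, dist y (TopologicalSpace.denseSeq Y k) < 1 / ((n : ℝ) + 1) := by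
    intro n y
    exact (TopologicalSpace.denseRange_denseSeq Y).exists_dist_lt y (by positivity)
  let a : Y → ℕ → ℕ := fun y n => Nat.find (h1 n y)
  have ha : Measurable a := by
    refine measurable_pi_lambda _ fun n => ?_
    refine measurable_find (h1 n) (fun k => ?_)
    exact (isOpen_lt (by fun_prop) (by fun_prop)).measurableSet
  refine ⟨a, ?_, ?_⟩
  · obtain ⟨t', h, h', h''⟩ := ha.exists_continuous
    exact ⟨t', h, h'', h'⟩
  · intro b F hF
    have htb : TotallyBounded {y | ∀ n, a y n ≤ b n} := by
      rw [Metric.totallyBounded_iff]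
      intro ε hε
      obtain ⟨n, hn⟩ := exists_nat_one_div_lt hε
      refine ⟨TopologicalSpace.denseSeq Y '' (Set.Iic (b n)), (Set.finite_Iic _).image _, ?_⟩
      intro y hy
      simp only [Set.mem_iUnion]
      exact ⟨_, ⟨a y n, hy n, rfl⟩, (Nat.find_spec (h1 n y)).trans hn⟩
    have := totallyBounded_iff_ultrafilter.1 htb F (Filter.le_principal_iff.2 hF)
    exact CompleteSpace.complete this

lemma L3 (Y : Type u) [t : TopologicalSpace Y] [ht : PolishSpace Y] :
    ∃ g : Y → ℕ → ℕ, ∀ K, IsCompact K → IsCompact (g ⁻¹' K) := by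
  choose a ha hF using L3a Y
  choose nx hle hpol hcont using ha
  let T : ℕ → {t : TopologicalSpace Y // @PolishSpace Y t} := fun n =>
    Nat.rec ⟨t, ht⟩ (fun _ s => ⟨nx s.1 s.2, hpol s.1 s.2⟩) n
  have hT : ∀ n, (T (n+1)).1 = nx (T n).1 (T n).2 := fun n => rfl
  have hT0 : ∀ n, (T n).1 ≤ t := by
    intro n
    induction n with
    | zero => exact le_rfl
    | succ n ih => exact (hle _ _).trans ih
  let g : Y → ℕ → ℕ := fun y m => a (T m.unpair.1).1 (T m.unpair.1).2 y m.unpair.2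
  refine ⟨g, fun K hK => ?_⟩
  rw [isCompact_iff_ultrafilter_le_nhds']
  intro F hFK
  have hb : ∀ m, ∃ b, ∀ z ∈ K, z m ≤ b := by
    intro m
    obtain ⟨b, hb⟩ := (hK.image (continuous_apply m)).bddAbove
    exact ⟨b, fun z hz => hb ⟨z, hz, rfl⟩⟩
  choose b hb using hb
  have hlim : ∀ i, ∃ y, (F : Filter Y) ≤ @nhds Y (T i).1 y := by
    intro i
    apply hF (T i).1 (T i).2 (fun n => b (Nat.pair i n)) F
    filter_upwards [hFK] with y hy n
    have := hb (Nat.pair i n) _ hy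
    simpa [g] using this
  choose y hy using hlim
  have hyt : ∀ i, (F : Filter Y) ≤ 𝓝 (y i) := fun i => (hy i).trans (nhds_mono (hT0 i))
  have hyy : ∀ i, y i = y 0 := fun i => tendsto_nhds_unique (f := id) (hyt i) (hyt 0)
  refine ⟨y 0, ?_, hyt 0⟩
  have hg : Filter.Tendsto g F (𝓝 (g (y 0))) := by
    rw [tendsto_pi_nhds]
    intro m
    have hc := hcont (T m.unpair.1).1 (T m.unpair.1).2
    have hc' := @Continuous.tendsto _ _ (nx _ _) _ _ hc (y 0)
    have h2 := hy (m.unpair.1 + 1)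
    rw [hyy] at h2
    exact (tendsto_pi_nhds.1 (hc'.mono_left h2)) m.unpair.2
  exact hK.isClosed.mem_of_tendsto hg hFK

lemma L2 {I : Type u} (c : (ℕ → ℕ) → I) (hc : ∀ i, IsClosed (c ⁻¹' {i}))
    (hu : ¬ (Set.range c).Countable) :
    ∃ e : (ℕ → ℕ) → (ℕ → ℕ), ∀ i, IsCompact ((fun z => c (e z)) ⁻¹' {i}) := by
  classical
  let W : Set (ℕ → ℕ) := {x | ∀ n, ¬ (c '' PiNat.cylinder x n).Countable}
  have hWc : (c '' Wᶜ).Countable := by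
    have : ∀ x : (Wᶜ : Set (ℕ → ℕ)), ∃ n, (c '' PiNat.cylinder x.1 n).Countable := by
      intro x
      by_contra! hh
      exact x.2 hh
    choose N hN using this
    obtain ⟨T, hT, hTU⟩ := TopologicalSpace.isOpen_iUnion_countable
      (fun x : (Wᶜ : Set (ℕ → ℕ)) => PiNat.cylinder x.1 (N x))
      (fun x => PiNat.isOpen_cylinder _ _ _)
    refine Set.Countable.mono ?_ (hT.biUnion (fun x _ => hN x))
    rintro _ ⟨x, hx, rfl⟩
    have : x ∈ ⋃ i ∈ T, PiNat.cylinder i.1 (N i) := by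
      rw [hTU]
      exact Set.mem_iUnion.2 ⟨⟨x, hx⟩, PiNat.self_mem_cylinder _ _⟩
    simp only [Set.mem_iUnion] at this ⊢
    obtain ⟨i, hi, hxi⟩ := this
    exact ⟨i, hi, x, hxi, rfl⟩
  have hWne : ∃ x, x ∈ W := by
    by_contra! hne
    apply hu
    refine hWc.mono ?_
    rintro _ ⟨x, rfl⟩
    exact ⟨x, hne x, rfl⟩
  obtain ⟨x0, hx0⟩ := hWne
  have hstep : ∀ (s : W × ℕ) (n : ℕ), ∃ s' : W × ℕ,
      s.2 + 1 ≤ s'.2 ∧ (∀ y ∈ PiNat.cylinder s'.1.1 s'.2, y ∈ PiNat.cylinder s.1.1 s.2 ∧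
        y ∈ PiNat.cylinder s.1.1 n ∧ c y ≠ c s.1.1) := by
    rintro ⟨⟨x, hx⟩, l⟩ n
    have h1 : ∃ x' ∈ W, x' ∈ PiNat.cylinder x (max l n) ∧ c x' ≠ c x := by
      by_contra! hcon
      apply hx (max l n)
      refine (hWc.union (Set.countable_singleton (c x))).mono ?_
      rintro _ ⟨y, hy, rfl⟩
      by_cases hyW : y ∈ W
      · right; exact hcon y hyW hy
      · left; exact ⟨y, hyW, rfl⟩
    obtain ⟨x', hx'W, hx', hne⟩ := h1
    have hop : IsOpen ((c ⁻¹' {c x})ᶜ) := (hc _).isOpen_compl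
    obtain ⟨_, ⟨w, k, rfl⟩, hxk, hsub⟩ :=
      (PiNat.isTopologicalBasis_cylinders (fun _ : ℕ => ℕ)).exists_subset_of_mem_open
        (show x' ∈ (c ⁻¹' {c x})ᶜ from hne) hop
    rw [← PiNat.mem_cylinder_iff_eq.1 hxk] at hsub
    refine ⟨⟨⟨x', hx'W⟩, max (max (l + 1) n) k⟩, by simp, ?_⟩
    intro y hy
    have hy1 : ∀ i < max (max (l + 1) n) k, y i = x' i := hy
    have hx1 : ∀ i < max l n, x' i = x i := hx'
    refine ⟨fun i hi => ?_, fun i hi => ?_, ?_⟩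
    · rw [hy1 i (by grind), hx1 i (by grind)]
    · rw [hy1 i (by grind), hx1 i (by grind)]
    · exact hsub (show y ∈ PiNat.cylinder x' k from fun i hi => hy1 i (by grind))
  choose step hs1 hs2 using hstep
  let st : List ℕ → W × ℕ := fun l => List.rec (⟨x0, hx0⟩, 0) (fun n _ s => step s n) l
  have st_cons : ∀ n l, st (n :: l) = step (st l) n := fun n l => rfl
  let e : (ℕ → ℕ) → (ℕ → ℕ) := fun z m => (st (PiNat.res z (m + 1))).1.1 m
  have hres : ∀ (z : ℕ → ℕ) k, PiNat.res z (k+1) = z k :: PiNat.res z k := fun z k => rfl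
  have hlen : ∀ z k, k ≤ (st (PiNat.res z k)).2 := by
    intro z k
    induction k with
    | zero => simp
    | succ k ih =>
      rw [hres, st_cons]
      have := hs1 (st (PiNat.res z k)) (z k)
      omega
  have hanti : ∀ z k j, PiNat.cylinder (st (PiNat.res z (k+j))).1.1 (st (PiNat.res z (k+j))).2
      ⊆ PiNat.cylinder (st (PiNat.res z k)).1.1 (st (PiNat.res z k)).2 := by
    intro z k j
    induction j with
    | zero => exact subset_rfl
    | succ j ih =>
      refine subset_trans ?_ ih
      rw [← add_assoc, hres, st_cons]
      intro y hy
      exact (hs2 _ _ y hy).1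
  have he : ∀ z k, e z ∈ PiNat.cylinder (st (PiNat.res z k)).1.1 (st (PiNat.res z k)).2 := by
    intro z k m hm
    rcases le_total k (m+1) with h | h
    · obtain ⟨j, hj⟩ := Nat.exists_eq_add_of_le h
      have := hanti z k j (PiNat.self_mem_cylinder _ _) m hm
      rw [← hj] at this
      exact this
    · obtain ⟨j, hj⟩ := Nat.exists_eq_add_of_le h
      have h2 := hlen z (m+1)
      have := hanti z (m+1) j (PiNat.self_mem_cylinder _ _) m (by omega)
      rw [← hj] at this
      exact this.symm
  have hecont : Continuous e := by
    refine continuous_pi fun m => ?_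
    rw [continuous_iff_continuousAt]
    intro z
    have : (fun z' => e z' m) =ᶠ[nhds z] fun _ => e z m := by
      filter_upwards [(PiNat.isOpen_cylinder (fun _ : ℕ => ℕ) z (m+1)).mem_nhds
        (PiNat.self_mem_cylinder _ _)] with z' hz'
      have : PiNat.res z' (m+1) = PiNat.res z (m+1) := by
        rw [PiNat.res_eq_res]
        intro i hi
        exact hz' i hi
      simp only [e, this]
    exact continuousAt_const.congr this.symm
  refine ⟨e, fun i => ?_⟩
  set D := (fun z => c (e z)) ⁻¹' {i} with hD
  have hDcl : IsClosed D := (hc i).preimage hecont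
  have hfin : ∀ k l, {n | ∃ z ∈ D, PiNat.res z k = l ∧ z k = n}.Finite := by
    intro k l
    by_contra hinf
    have hinf : {n | ∃ z ∈ D, PiNat.res z k = l ∧ z k = n}.Infinite := hinf
    have key : ∀ n, (∃ z ∈ D, PiNat.res z k = l ∧ z k = n) →
        ∃ y, c y = i ∧ y ∈ PiNat.cylinder (st l).1.1 n ∧ c y ≠ c (st l).1.1 := by
      rintro n ⟨z, hz, hl, hn⟩
      have h3 := he z (k+1)
      rw [hres, st_cons, hl, hn] at h3
      have := hs2 _ _ _ h3
      exact ⟨e z, hz, this.2⟩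
    have hcl : (st l).1.1 ∈ closure (c ⁻¹' {i}) := by
      rw [(PiNat.isTopologicalBasis_cylinders (fun _ : ℕ => ℕ)).mem_closure_iff]
      rintro _ ⟨w, m, rfl⟩ hw
      obtain ⟨n, hn, hmn⟩ := hinf.exists_gt m
      obtain ⟨y, hy1, hy2, -⟩ := key n hn
      refine ⟨y, ?_, hy1⟩
      rw [← PiNat.mem_cylinder_iff_eq.1 hw]
      exact PiNat.cylinder_anti _ hmn.le hy2
    rw [(hc i).closure_eq] at hcl
    obtain ⟨n, hn⟩ := hinf.nonempty
    obtain ⟨y, hy1, -, hy3⟩ := key n hn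
    exact hy3 (hy1.trans (Eq.symm hcl))
  have hT : ∀ k, ((fun z => PiNat.res z k) '' D).Finite := by
    intro k
    induction k with
    | zero => exact (Set.finite_singleton []).subset (by rintro _ ⟨z, _, rfl⟩; rfl)
    | succ k ih =>
      refine (ih.biUnion (fun l _ => (hfin k l).image (fun n => n :: l))).subset ?_
      rintro _ ⟨z, hz, rfl⟩
      simp only [Set.mem_iUnion]
      exact ⟨PiNat.res z k, ⟨z, hz, rfl⟩, z k, ⟨z, hz, rfl, rfl⟩, rfl⟩
  have hV : ∀ k, ((fun z : ℕ → ℕ => z k) '' D).Finite := by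
    intro k
    refine ((hT (k+1)).image (fun l => l.headI)).subset ?_
    rintro _ ⟨z, hz, rfl⟩
    exact ⟨_, ⟨z, hz, rfl⟩, rfl⟩
  refine (isCompact_univ_pi (fun k => (hV k).isCompact)).of_isClosed_subset hDcl ?_
  intro z hz k _
  exact ⟨z, hz, rfl⟩

lemma L4 (Y : Type u) [t : TopologicalSpace Y] [PolishSpace Y] [Uncountable Y]
    [Uncountable (ℕ → ℕ)] :
    ∃ (g φ : Y → ℕ → ℕ), Function.Surjective φ ∧
      ∀ K C, IsCompact K → IsClosed C → IsCompact (g ⁻¹' K ∩ φ ⁻¹' C) := by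
  let : MeasurableSpace Y := borel Y
  have : BorelSpace Y := ⟨rfl⟩
  let φ : Y ≃ᵐ (ℕ → ℕ) := PolishSpace.measurableEquivOfNotCountable
    (not_countable_iff.2 inferInstance) (not_countable_iff.2 inferInstance)
  obtain ⟨t', hle, hφ, hpol⟩ := φ.measurable.exists_continuous
  obtain ⟨g, hg⟩ := @L3 Y t' hpol
  refine ⟨g, φ, φ.surjective, fun K C hK hC => ?_⟩
  have h2 : @IsCompact Y t' (g ⁻¹' K ∩ φ ⁻¹' C) :=
    @IsCompact.inter_right Y t' _ _ (hg _ hK) (@IsClosed.preimage _ _ t' _ _ hφ _ hC)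
  have h3 := @IsCompact.image _ _ t' t _ id h2 (continuous_id_iff_le.2 hle)
  rwa [Set.image_id] at h3

/-- If some uncountable Polish space admits a partition into exactly `κ` nonempty
`Fσ` sets (`κ` uncountable), then every uncountable Polish space admits a
partition into exactly `κ` nonempty compact sets. -/
theorem some_fsigma_partition_to_every_compact_partition
    (κ : Cardinal.{u}) (hκ : ℵ₀ < κ)
    (X : Type u) [TopologicalSpace X] [PolishSpace X] [Uncountable X]
    (h : ∃ P : Set (Set X),
      (∀ s ∈ P, s.Nonempty) ∧
      (∀ s ∈ P, IsFsigma s) ∧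
      P.PairwiseDisjoint id ∧
      ⋃₀ P = Set.univ ∧
      #P = κ)
    (Y : Type u) [TopologicalSpace Y] [PolishSpace Y] [Uncountable Y] :
    ∃ Q : Set (Set Y),
      (∀ s ∈ Q, s.Nonempty) ∧
      (∀ s ∈ Q, IsCompact s) ∧
      Q.PairwiseDisjoint id ∧
      ⋃₀ Q = Set.univ ∧
      #Q = κ := by
  obtain ⟨P, hne, hfs, hdisj, hcov, hcard⟩ := h
  obtain ⟨f, hf, hfsurj⟩ := PolishSpace.exists_nat_nat_continuous_surjective X
  have hex : ∀ x : X, ∃ s : P, x ∈ s.1 := by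
    intro x
    have : x ∈ ⋃₀ P := by rw [hcov]; trivial
    obtain ⟨s, hs, hx⟩ := this
    exact ⟨⟨s, hs⟩, hx⟩
  choose p0 hp0 using hex
  have hp0' : ∀ x (s : P), p0 x = s ↔ x ∈ s.1 := by
    intro x s
    refine ⟨fun h => h ▸ hp0 x, fun h => ?_⟩
    by_contra hn
    exact Set.disjoint_left.1 (hdisj (p0 x).2 s.2 (fun h => hn (Subtype.ext h))) (hp0 x) h
  obtain ⟨r, hr⟩ := L1 (fun x => p0 (f x)) (by
    intro s
    obtain ⟨F, hF, hs⟩ := hfs s.1 s.2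
    refine ⟨fun n => f ⁻¹' F n, fun n => (hF n).preimage hf, ?_⟩
    ext x
    rw [← Set.preimage_iUnion, ← hs]
    exact hp0' _ _)
  set c : (ℕ → ℕ) → P × ℕ × ℕ := fun x => (p0 (f x), r x) with hcdef
  have hp0surj : Function.Surjective p0 := by
    intro s
    obtain ⟨x, hx⟩ := hne s.1 s.2
    exact ⟨x, (hp0' _ _).2 hx⟩
  have hI : #(P × ℕ × ℕ) = κ := by
    simp only [Cardinal.mk_prod, hcard, Cardinal.mk_nat, Cardinal.lift_id, Cardinal.lift_aleph0,
      Cardinal.aleph0_mul_aleph0, Cardinal.lift_uzero]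
    exact Cardinal.mul_aleph0_eq hκ.le
  have hcu : ¬ (Set.range c).Countable := by
    intro hc
    have h1 := hc.image Prod.fst
    have h2 : Prod.fst '' Set.range c = Set.univ := by
      rw [← Set.range_comp]
      exact (hp0surj.comp hfsurj).range_eq
    rw [h2, Set.countable_univ_iff, ← Cardinal.mk_le_aleph0_iff, hcard] at h1
    exact absurd h1 (not_le.2 hκ)
  obtain ⟨e, he⟩ := L2 c hr hcu
  have : Uncountable (ℕ → ℕ) := hfsurj.uncountable
  obtain ⟨g, φ, hφ, hgφ⟩ := L4 Y
  let q : Y → (P × ℕ × ℕ) × (P × ℕ × ℕ) := fun y => (c (e (g y)), c (φ y))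
  have hq : ∀ j, IsCompact (q ⁻¹' {j}) := by
    rintro ⟨i, j⟩
    have h1 : q ⁻¹' {(i, j)} = (g ⁻¹' ((fun z => c (e z)) ⁻¹' {i})) ∩ (φ ⁻¹' (c ⁻¹' {j})) := by
      ext y
      simp [q]
    rw [h1]
    exact hgφ _ _ (he i) (hr j)
  refine ⟨Set.range (fun j : Set.range q => q ⁻¹' {j.1}), ?_, ?_, ?_, ?_, ?_⟩
  · rintro _ ⟨⟨_, y, rfl⟩, rfl⟩
    exact ⟨y, rfl⟩
  · rintro _ ⟨j, rfl⟩
    exact hq _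
  · rintro _ ⟨j, rfl⟩ _ ⟨k, rfl⟩ hjk
    refine Set.disjoint_left.2 fun y hy hy' => hjk ?_
    have h1 : q y = j.1 := hy
    have h2 : q y = k.1 := hy'
    simp only [← h1, ← h2]
  · refine Set.eq_univ_of_forall fun y => ?_
    exact ⟨_, ⟨⟨q y, y, rfl⟩, rfl⟩, rfl⟩
  · rw [Cardinal.mk_range_eq]
    · apply le_antisymm
      · refine (Cardinal.mk_set_le _).trans ?_
        rw [Cardinal.mk_prod, Cardinal.lift_id, hI, Cardinal.mul_eq_self hκ.le]
      · rw [← hcard]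
        have : Function.Surjective (fun j : Set.range q => j.1.2.1) := by
          intro s
          obtain ⟨x, hx⟩ := (hp0surj.comp hfsurj) s
          obtain ⟨y, rfl⟩ := hφ x
          exact ⟨⟨q y, _, rfl⟩, hx⟩
        exact Cardinal.mk_le_of_surjective this
    · rintro ⟨_, y, rfl⟩ ⟨k, hk⟩ hjk
      have : y ∈ q ⁻¹' {k} := by
        have h0 : y ∈ q ⁻¹' {q y} := rfl
        simp only at hjk
        rwa [hjk] at h0
      exact Subtype.ext this
end

section
/- Let X be an uncountable Polish space and let κ be an uncountable cardinal. Then the following are equivalent: (i) X admits a partition into exactly κ nonempty compact sets; (ii) X admits a partition into exactly κ nonempty closed sets; (iii) X admits a partition into exactly κ nonempty F_σ sets. -/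
open Cardinal

universe u

/-- `X` admits a partition into exactly `κ` nonempty sets, each satisfying `p`. -/
def HasPartitionInto {X : Type u} (κ : Cardinal.{u}) (p : Set X → Prop) : Prop :=
  ∃ P : Set (Set X),
    (∀ s ∈ P, s.Nonempty) ∧
    (∀ s ∈ P, p s) ∧
    P.PairwiseDisjoint id ∧
    ⋃₀ P = Set.univ ∧
    #P = κ


section Helpers
open Set Filter Topology

/-- Step lemma. -/
lemma step_refine {X ι : Type*} [MetricSpace X] [SecondCountableTopology X] [Nonempty X]
    (r : X → ι) (hr : ∀ i, IsFsigma (r ⁻¹' {i})) (ε : ℝ) (hε : 0 < ε) :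
    ∃ t : X → ℕ, (∀ i n, IsFsigma {x | r x = i ∧ t x = n}) ∧
      (∀ y, closure {x | r x = r y ∧ t x = t y} ⊆ {x | r x = r y}) ∧
      (∀ x y, r x = r y → t x = t y → dist x y ≤ 2 * ε) := by
  classical
  choose F hFc hF using hr
  let d := TopologicalSpace.denseSeq X
  have hm : ∀ x, ∃ m, x ∈ F (r x) m := by
    intro x
    have : x ∈ r ⁻¹' {r x} := rfl
    rw [hF] at this
    simpa using this
  have hj : ∀ x, ∃ j, dist x (d j) < ε := fun x =>
    (TopologicalSpace.denseRange_denseSeq X).exists_dist_lt x hε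
  have key : ∀ i n, {x | r x = i ∧ Nat.pair (Nat.find (hm x)) (Nat.find (hj x)) = n} =
      (F i n.unpair.1 ∩ ⋂ k ∈ Finset.range n.unpair.2, {x | ε ≤ dist x (d k)}) ∩
        ((⋂ k ∈ Finset.range n.unpair.1, (F i k)ᶜ) ∩ {x | dist x (d n.unpair.2) < ε}) := by
    intro i n
    have hFi : ∀ x k, x ∈ F i k → r x = i := by
      intro x k hx
      have : x ∈ r ⁻¹' {i} := by rw [hF]; exact mem_iUnion.2 ⟨k, hx⟩
      exact this
    ext x
    have h1 : Nat.pair (Nat.find (hm x)) (Nat.find (hj x)) = n ↔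
      Nat.find (hm x) = n.unpair.1 ∧ Nat.find (hj x) = n.unpair.2 := by
      constructor
      · rintro rfl; simp
      · rintro ⟨h, h'⟩; rw [h, h', Nat.pair_unpair]
    simp only [mem_ofPred_eq, h1, Nat.find_eq_iff, mem_inter_iff, mem_iInter, Finset.mem_range,
      mem_compl_iff, not_lt]
    constructor
    · rintro ⟨rfl, ⟨a, b⟩, c, e⟩
      exact ⟨⟨a, e⟩, b, c⟩
    · rintro ⟨⟨a, e⟩, b, c⟩
      obtain rfl := hFi _ _ a
      exact ⟨rfl, ⟨a, b⟩, c, e⟩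
  refine ⟨fun x => Nat.pair (Nat.find (hm x)) (Nat.find (hj x)), ?_, ?_, ?_⟩
  · intro i n
    rw [key]
    have hcl : IsClosed (F i n.unpair.1 ∩
        ⋂ k ∈ Finset.range n.unpair.2, {x | ε ≤ dist x (d k)}) := by
      refine (hFc _ _).inter (isClosed_biInter fun k _ => ?_)
      exact isClosed_le continuous_const (by fun_prop)
    have hop : IsOpen ((⋂ k ∈ Finset.range n.unpair.1, (F i k)ᶜ) ∩
        {x | dist x (d n.unpair.2) < ε}) := by
      refine IsOpen.inter (isOpen_biInter_finset fun k _ => (hFc _ _).isOpen_compl) ?_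
      exact isOpen_lt (by fun_prop) continuous_const
    obtain ⟨G, hG, -, hG2, -⟩ := hop.exists_iUnion_isClosed
    refine ⟨fun k => _ ∩ G k, fun k => hcl.inter (hG k), ?_⟩
    rw [← inter_iUnion, hG2]
  · intro y
    have : closure {x | r x = r y ∧ Nat.pair (Nat.find (hm x)) (Nat.find (hj x)) =
        Nat.pair (Nat.find (hm y)) (Nat.find (hj y))} ⊆ F (r y) (Nat.find (hm y)) := by
      refine closure_minimal ?_ (hFc _ _)
      rw [key]
      simp only [Nat.unpair_pair]
      exact fun x hx => hx.1.1
    refine this.trans fun x hx => ?_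
    have h2 : x ∈ r ⁻¹' {r y} := by rw [hF]; exact mem_iUnion.2 ⟨_, hx⟩
    exact h2
  · intro x y _ h
    have h2 : Nat.find (hj x) = Nat.find (hj y) := (Nat.pair_eq_pair.1 h).2
    have hx := Nat.find_spec (hj x)
    have hy := Nat.find_spec (hj y)
    rw [h2] at hx
    have := dist_triangle_right x y (d (Nat.find (hj y)))
    linarith

lemma exists_coding {X ι : Type*} [MetricSpace X] [CompleteSpace X] [SecondCountableTopology X]
    [Nonempty X] (c : X → ι) (hc : ∀ i, IsFsigma (c ⁻¹' {i})) :
    ∃ a : X → ℕ → ℕ, ∀ (i : ι) (Q : Set (ℕ → ℕ)), IsCompact Q →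
      IsCompact {x | c x = i ∧ a x ∈ Q} := by
  let St := {q : X → ℕ // ∀ i n, IsFsigma {x | c x = i ∧ q x = n}}
  have hstep : ∀ (q : St) (k : ℕ), ∃ q' : St,
      (∀ y, closure {x | c x = c y ∧ q'.1 x = q'.1 y} ⊆ {x | c x = c y ∧ q.1 x = q.1 y}) ∧
      (∀ x y, c x = c y → q'.1 x = q'.1 y → dist x y ≤ 2 * (1/2)^k) := by
    rintro ⟨q, hq⟩ k
    obtain ⟨t, h1, h2, h3⟩ := step_refine (fun x => (c x, q x)) (fun i => by
      convert hq i.1 i.2 using 1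
      ext x; simp [Prod.ext_iff]) ((1/2)^k) (by positivity)
    refine ⟨⟨fun x => Nat.pair (q x) (t x), fun i n => ?_⟩, ?_, ?_⟩
    · convert h1 (i, n.unpair.1) n.unpair.2 using 1
      ext x
      simp only [mem_ofPred_eq, Prod.mk.injEq, and_assoc]
      refine and_congr_right fun _ => ?_
      constructor
      · rintro rfl; simp
      · rintro ⟨h, h'⟩; rw [h, h', Nat.pair_unpair]
    · intro y
      simpa [Nat.pair_eq_pair, and_assoc, Prod.ext_iff] using h2 y
    · intro x y hx hxy
      have := Nat.pair_eq_pair.1 hxy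
      exact h3 x y (by simp [hx, this.1]) this.2
  choose nx hnx1 hnx2 using hstep
  let q0 : St := ⟨fun _ => 0, fun i n => by
    by_cases h : (0:ℕ) = n
    · simp only [h, and_true]; exact hc i
    · exact ⟨fun _ => ∅, fun _ => isClosed_empty, by simp [h]⟩⟩
  let s : ℕ → St := fun n => Nat.rec q0 (fun k q => nx q k) n
  have hs : ∀ n, s (n+1) = nx (s n) n := fun n => rfl
  refine ⟨fun x n => (s n).1 x, fun i Q hQ => ?_⟩
  apply IsSeqCompact.isCompact
  intro x hx
  obtain ⟨β, hβ, φ, hφ, hlim⟩ := hQ.isSeqCompact (fun n => (hx n).2)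
  have hev : ∀ k, ∀ᶠ n in atTop, (s k).1 (x (φ n)) = β k := by
    intro k
    have := (tendsto_pi_nhds.1 hlim) k
    simpa [nhds_discrete] using this
  have hcau : CauchySeq (x ∘ φ) := by
    rw [Metric.cauchySeq_iff']
    intro ε hε
    obtain ⟨k, hk⟩ := exists_pow_lt_of_lt_one (show 0 < ε/2 by positivity)
      (show (1/2:ℝ) < 1 by norm_num)
    obtain ⟨N, hN⟩ := eventually_atTop.1 (hev (k+1))
    refine ⟨N, fun n hn => ?_⟩
    have := hnx2 (s k) k (x (φ n)) (x (φ N)) ((hx _).1.trans (hx _).1.symm)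
      (by rw [← hs]; exact (hN n hn).trans (hN N le_rfl).symm)
    simp only [Function.comp]
    linarith
  obtain ⟨z, hz⟩ := cauchySeq_tendsto_of_complete hcau
  have hzz : ∀ k, c z = i ∧ (s k).1 z = β k := by
    intro k
    obtain ⟨N, hN⟩ := eventually_atTop.1 ((hev k).and (hev (k+1)))
    have hmem : z ∈ closure {w | c w = c (x (φ N)) ∧
        (nx (s k) k).1 w = (nx (s k) k).1 (x (φ N))} := by
      refine mem_closure_of_tendsto hz ?_
      filter_upwards [eventually_ge_atTop N] with n hn
      refine ⟨(hx _).1.trans (hx _).1.symm, ?_⟩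
      rw [← hs]; exact (hN n hn).2.trans (hN N le_rfl).2.symm
    have := hnx1 _ _ _ hmem
    exact ⟨this.1.trans (hx _).1, this.2.trans (hN N le_rfl).1⟩
  refine ⟨z, ⟨(hzz 0).1, ?_⟩, φ, hφ, hz⟩
  convert hβ using 1
  ext k
  exact (hzz k).2

/-- Disjointification in Baire space. -/
lemma exists_disjointify (S : Set (ℕ → ℕ)) (hS : IsSigmaCompact S) :
    ∃ g : (ℕ → ℕ) → ℕ × List ℕ, ∀ j, IsCompact {x | x ∈ S ∧ g x = j} := by
  classical
  obtain ⟨K, hK, rfl⟩ := hS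
  let n : (ℕ → ℕ) → ℕ := fun x => sInf {n | x ∈ K n}
  have hn : ∀ x ∈ ⋃ n, K n, x ∈ K (n x) := fun x hx => Nat.sInf_mem (s := {n | x ∈ K n}) (by
    obtain ⟨i, hi⟩ := mem_iUnion.1 hx
    exact ⟨i, hi⟩)
  have hn' : ∀ x, ∀ m < n x, x ∉ K m := fun x m hm h => Nat.notMem_of_lt_sInf hm h
  let H : ℕ → Set (ℕ → ℕ) := fun n => ⋃ m ∈ Finset.range n, K m
  have hH : ∀ n, IsClosed (H n) := fun n =>
    isClosed_biUnion_finset fun m _ => (hK m).isClosed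
  have hex : ∀ x, ∃ l, Disjoint (H (n x)) (PiNat.cylinder x l) := by
    intro x
    have hxH : x ∉ H (n x) := by
      simp only [H, mem_iUnion, Finset.mem_range, not_exists]
      exact fun m hm => hn' x m hm
    have := PiNat.exists_disjoint_cylinder (hH (n x)) hxH
    exact this
  let l : (ℕ → ℕ) → ℕ := fun x => Nat.find (hex x)
  refine ⟨fun x => (n x, PiNat.res x (l x)), fun j => ?_⟩
  by_cases hne : {x | x ∈ ⋃ n, K n ∧ (n x, PiNat.res x (l x)) = j}.Nonempty
  swap
  · rw [not_nonempty_iff_eq_empty.1 hne]; exact isCompact_empty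
  obtain ⟨x, hx, hj⟩ := hne
  have : {y | y ∈ ⋃ n, K n ∧ (n y, PiNat.res y (l y)) = j} =
      K (n x) ∩ PiNat.cylinder x (l x) := by
    subst hj
    ext y
    simp only [mem_ofPred_eq, Prod.mk.injEq, mem_inter_iff]
    constructor
    · rintro ⟨hy, h1, h2⟩
      have hl : l y = l x := by
        have := congrArg List.length h2
        simpa using this
      refine ⟨h1 ▸ hn y hy, ?_⟩
      rw [hl] at h2
      rw [PiNat.cylinder_eq_res]
      exact h2
    · rintro ⟨h1, h2⟩
      have hyn : n y = n x := by
        apply le_antisymm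
        · exact Nat.sInf_le h1
        · by_contra hlt
          push Not at hlt
          have hd := Nat.find_spec (hex x)
          refine disjoint_left.1 hd ?_ h2
          simp only [H, mem_iUnion, Finset.mem_range]
          exact ⟨n y, hlt, hn y (mem_iUnion.2 ⟨_, h1⟩)⟩
      have hcyl : ∀ m ≤ l x, PiNat.cylinder y m = PiNat.cylinder x m := fun m hm =>
        PiNat.mem_cylinder_iff_eq.1 (PiNat.cylinder_anti x hm h2)
      have hl : l y = l x := by
        simp only [l]
        rw [Nat.find_eq_iff]
        constructor
        · rw [hyn]
          rw [show PiNat.cylinder y _ = _ from hcyl _ le_rfl]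
          exact Nat.find_spec (hex x)
        · intro m hm
          rw [hyn, hcyl m hm.le]
          exact Nat.find_min (hex x) hm
      refine ⟨mem_iUnion.2 ⟨_, h1⟩, hyn, ?_⟩
      rw [hl]
      rw [PiNat.cylinder_eq_res] at h2
      exact h2
  have hclc : IsClosed (PiNat.cylinder x (l x)) := by
    have : PiNat.cylinder x (l x) = ⋂ i ∈ Finset.range (l x), {y : ℕ → ℕ | y i = x i} := by
      ext y
      simp [PiNat.cylinder]
    rw [this]
    exact isClosed_biInter fun i _ => isClosed_eq (continuous_apply i) continuous_const
  rw [this]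
  exact (hK _).inter_right hclc

/-- nodes along a branch -/
def nodeSeq (α : ℕ → ℕ) : ℕ → ℕ
  | 0 => 0
  | k+1 => Nat.pair (nodeSeq α k) (α k) + 1

lemma nodeSeq_lt (α : ℕ → ℕ) (k : ℕ) : nodeSeq α k < nodeSeq α (k+1) :=
  Nat.lt_succ_of_le (Nat.left_le_pair _ _)

lemma nodeSeq_strictMono (α : ℕ → ℕ) : StrictMono (nodeSeq α) :=
  strictMono_nat_of_lt_succ (nodeSeq_lt α)

lemma nodeSeq_continuous (k : ℕ) : Continuous (fun α => nodeSeq α k) := by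
  induction k with
  | zero => exact continuous_const
  | succ k ih =>
    exact (continuous_of_discreteTopology (f := fun p : ℕ × ℕ => Nat.pair p.1 p.2 + 1)).comp
      (ih.prodMk (continuous_apply k))

lemma isCompact_of_finBranch (T : Set (ℕ → ℕ)) (hT : IsClosed T)
    (h : ∀ k w, {n | ∃ α ∈ T, nodeSeq α k = w ∧ α k = n}.Finite) : IsCompact T := by
  have h1 : ∀ k, {w | ∃ α ∈ T, nodeSeq α k = w}.Finite ∧ {n | ∃ α ∈ T, α k = n}.Finite := by
    have h2 : ∀ k, {w | ∃ α ∈ T, nodeSeq α k = w}.Finite → {n | ∃ α ∈ T, α k = n}.Finite := by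
      intro k hk
      refine (hk.biUnion (fun w _ => h k w)).subset ?_
      rintro n ⟨α, hα, rfl⟩
      exact mem_biUnion (show nodeSeq α k ∈ _ from ⟨α, hα, rfl⟩) ⟨α, hα, rfl, rfl⟩
    intro k
    induction k with
    | zero =>
      have h0 : {w | ∃ α ∈ T, nodeSeq α 0 = w}.Finite := by
        refine (finite_singleton 0).subset ?_
        rintro w ⟨α, hα, rfl⟩
        rfl
      exact ⟨h0, h2 0 h0⟩
    | succ k ih =>
      have h0 : {w | ∃ α ∈ T, nodeSeq α (k+1) = w}.Finite := by
        refine (ih.1.image2 (fun a b => Nat.pair a b + 1) ih.2).subset ?_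
        rintro w ⟨α, hα, rfl⟩
        exact ⟨_, ⟨α, hα, rfl⟩, _, ⟨α, hα, rfl⟩, rfl⟩
      exact ⟨h0, h2 _ h0⟩
  refine (isCompact_univ_pi (fun k => (h1 k).2.isCompact)).of_isClosed_subset hT ?_
  intro α hα k _
  exact ⟨α, hα, rfl⟩

lemma exists_tree_points {X ι : Type*} [MetricSpace X] [SecondCountableTopology X]
    (c : X → ι) (hc : ¬ (range c).Countable) :
    ∃ y : ℕ → X, Function.Injective (c ∘ y) ∧
      ∀ n, dist (y (n+1)) (y n.unpair.1) ≤ (1/2)^(n+1) := by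
  classical
  let B := TopologicalSpace.countableBasis X
  let U : Set X := ⋃₀ {b ∈ B | (c '' b).Countable}
  have hU : (c '' U).Countable := by
    rw [image_sUnion]
    refine Countable.sUnion ?_ ?_
    · exact ((TopologicalSpace.countable_countableBasis X).mono (sep_subset _ _)).image _
    · rintro _ ⟨b, hb, rfl⟩
      exact hb.2
  have hY : ∀ x ∉ U, ∀ V : Set X, IsOpen V → x ∈ V → ∀ S : Set ι, S.Countable →
      ∃ z ∉ U, z ∈ V ∧ c z ∉ S := by
    intro x hx V hV hxV S hS
    by_contra hcon
    push Not at hcon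
    obtain ⟨b, hb, hxb, hbV⟩ :=
      (TopologicalSpace.isBasis_countableBasis X).exists_subset_of_mem_open hxV hV
    refine hx ⟨b, ⟨hb, (hU.union hS).mono ?_⟩, hxb⟩
    rintro _ ⟨z, hz, rfl⟩
    by_cases hzU : z ∈ U
    · exact Or.inl ⟨z, hzU, rfl⟩
    · exact Or.inr (hcon z hzU (hbV hz))
  have hne : ∃ x, x ∉ U := by
    by_contra hcon
    push Not at hcon
    apply hc
    refine hU.mono ?_
    rintro _ ⟨x, rfl⟩
    exact ⟨x, hcon x, rfl⟩
  obtain ⟨x0, hx0⟩ := hne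
  let Y := {x // x ∉ U}
  have hst : ∀ (x : Y) (n : ℕ) (S : Set ι), ∃ z : Y, S.Countable →
      dist z.1 x.1 ≤ (1/2)^(n+1) ∧ c z ∉ S := by
    rintro ⟨x, hx⟩ n S
    by_cases hS : S.Countable
    · obtain ⟨z, h1, h2, h3⟩ := hY x hx (Metric.ball x ((1/2)^(n+1))) Metric.isOpen_ball
        (Metric.mem_ball_self (by positivity)) S hS
      exact ⟨⟨z, h1⟩, fun _ => ⟨le_of_lt h2, h3⟩⟩
    · exact ⟨⟨x, hx⟩, fun h => absurd h hS⟩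
  choose g hg using hst
  let F : ∀ n : ℕ, (∀ m, m < n → Y) → Y := fun n => match n with
    | 0 => fun _ => ⟨x0, hx0⟩
    | n+1 => fun ih => g (ih n.unpair.1 (Nat.lt_succ_of_le (Nat.unpair_left_le n))) n
        (range fun m : Fin (n+1) => c (ih m.1 m.2).1)
  let y : ℕ → Y := fun n => Nat.lt_wfRel.wf.fix F n
  have hy : ∀ n, y (n+1) = g (y n.unpair.1) n (range fun m : Fin (n+1) => c (y m.1).1) :=
    fun n => Nat.lt_wfRel.wf.fix_eq F (n+1)
  have hy2 : ∀ n, dist (y (n+1)).1 (y n.unpair.1).1 ≤ (1/2)^(n+1) ∧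
      c (y (n+1)).1 ∉ (range fun m : Fin (n+1) => c (y m.1).1) := by
    intro n
    rw [hy n]
    exact hg _ _ _ (countable_range _)
  refine ⟨fun n => (y n).1, ?_, fun n => (hy2 n).1⟩
  have hlt : ∀ m n, m < n → c (y m).1 ≠ c (y n).1 := by
    intro m n hmn h
    cases n with
    | zero => omega
    | succ n => exact (hy2 n).2 ⟨⟨m, hmn⟩, h⟩
  intro m n h
  rcases lt_trichotomy m n with h' | h' | h'
  · exact absurd h (hlt _ _ h')
  · exact h'
  · exact absurd h.symm (hlt _ _ h')

lemma nodeSeq_congr {α β : ℕ → ℕ} {k : ℕ} (h : ∀ i < k, α i = β i) :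
    nodeSeq α k = nodeSeq β k := by
  induction k with
  | zero => rfl
  | succ k ih =>
    simp only [nodeSeq]
    rw [ih (fun i hi => h i (by omega)), h k (by omega)]

lemma exists_baire_map {X : Type*} [MetricSpace X] [CompleteSpace X]
    (y : ℕ → X) (hy : ∀ n, dist (y (n+1)) (y n.unpair.1) ≤ (1/2)^(n+1)) :
    ∃ f : (ℕ → ℕ) → X, Continuous f ∧
      ∀ α k, dist (f α) (y (nodeSeq α k)) ≤ 2 * (1/2)^(nodeSeq α (k+1)) := by
  have hstep : ∀ α k, dist (y (nodeSeq α k)) (y (nodeSeq α (k+1))) ≤ (1/2)^(nodeSeq α (k+1)) := by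
    intro α k
    have := hy (Nat.pair (nodeSeq α k) (α k))
    rw [dist_comm]
    simpa [nodeSeq] using this
  have hfin : ∀ α k j, dist (y (nodeSeq α k)) (y (nodeSeq α (k+j))) ≤
      2 * (1/2)^(nodeSeq α (k+1)) - (1/2)^(nodeSeq α (k+j)) * (if j = 0 then 0 else 1) := by
    intro α k j
    induction j with
    | zero => simp
    | succ j ih =>
      have h1 := dist_triangle (y (nodeSeq α k)) (y (nodeSeq α (k+j))) (y (nodeSeq α (k+(j+1))))
      have h2 := hstep α (k+j)
      rw [add_assoc] at h2
      by_cases hj : j = 0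
      · subst hj
        simp only [add_zero, dist_self, zero_add] at *
        norm_num
        norm_num at h2
        linarith
      · simp only [hj, if_false] at ih
        simp only [Nat.succ_ne_zero, if_false]
        have h3 : (1/2:ℝ)^(nodeSeq α (k+(j+1))) ≤ (1/2)^(nodeSeq α (k+j) + 1) :=
          pow_le_pow_of_le_one (by norm_num) (by norm_num) (nodeSeq_lt α (k+j))
        rw [pow_succ] at h3
        linarith
  have hpow : ∀ α k, (1/2:ℝ)^(nodeSeq α k) ≤ (1/2)^k := fun α k =>
    pow_le_pow_of_le_one (by norm_num) (by norm_num) ((nodeSeq_strictMono α).le_apply)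
  have hfin' : ∀ α k j, dist (y (nodeSeq α k)) (y (nodeSeq α (k+j))) ≤
      2 * (1/2)^(nodeSeq α (k+1)) := by
    intro α k j
    refine (hfin α k j).trans ?_
    have : (0:ℝ) ≤ (1/2)^(nodeSeq α (k+j)) * (if j = 0 then 0 else 1) := by
      split_ifs <;> positivity
    linarith
  have hlim : ∀ α, ∃ z, Tendsto (fun k => y (nodeSeq α k)) atTop (𝓝 z) := by
    intro α
    apply cauchySeq_tendsto_of_complete
    refine cauchySeq_of_le_geometric (1/2) 1 (by norm_num) fun k => ?_
    refine (hstep α k).trans ((hpow α (k+1)).trans ?_)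
    rw [one_mul]
    exact pow_le_pow_of_le_one (by norm_num) (by norm_num) (by omega)
  choose f hf using hlim
  have hd : ∀ α k, dist (f α) (y (nodeSeq α k)) ≤ 2 * (1/2)^(nodeSeq α (k+1)) := by
    intro α k
    rw [dist_comm]
    have h1 : Tendsto (fun j => dist (y (nodeSeq α k)) (y (nodeSeq α (k+j)))) atTop
        (𝓝 (dist (y (nodeSeq α k)) (f α))) := by
      refine tendsto_const_nhds.dist ((hf α).comp ?_)
      exact tendsto_atTop_mono (fun j => Nat.le_add_left j k) tendsto_id
    exact le_of_tendsto' h1 (hfin' α k)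
  refine ⟨f, ?_, hd⟩
  rw [continuous_iff_continuousAt]
  intro α
  rw [ContinuousAt, Metric.tendsto_nhds]
  intro ε hε
  obtain ⟨k, hk⟩ := exists_pow_lt_of_lt_one (show 0 < ε/4 by positivity)
      (show (1/2:ℝ) < 1 by norm_num)
  have hev : ∀ᶠ β in 𝓝 α, nodeSeq β k = nodeSeq α k := by
    have := (nodeSeq_continuous k).tendsto α
    simpa [nhds_discrete] using this
  filter_upwards [hev] with β hβ
  have h1 := hd α k
  have h2 := hd β k
  have h3 : ∀ γ : ℕ → ℕ, (1/2:ℝ)^(nodeSeq γ (k+1)) ≤ (1/2)^k := fun γ =>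
    (hpow γ (k+1)).trans (pow_le_pow_of_le_one (by norm_num) (by norm_num) (by omega))
  have h4 := h3 α
  have h5 := h3 β
  rw [hβ] at h2
  have := dist_triangle_right (f β) (f α) (y (nodeSeq α k))
  linarith

lemma preimage_sigmaCompact {X : Type*} [MetricSpace X]
    (y : ℕ → X) (f : (ℕ → ℕ) → X) (hf : Continuous f)
    (hd : ∀ α k, dist (f α) (y (nodeSeq α k)) ≤ 2 * (1/2)^(nodeSeq α (k+1)))
    (F : Set X) (hF : IsClosed F) (v : ℕ) (hv : ∀ w, w ≠ v → y w ∉ F) :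
    IsSigmaCompact (f ⁻¹' F) := by
  have hbr : ∀ k w, w ≠ v → {n | ∃ α ∈ f ⁻¹' F, nodeSeq α k = w ∧ α k = n}.Finite := by
    intro k w hw
    by_contra hinf
    apply hv w hw
    rw [← hF.closure_eq, Metric.mem_closure_iff]
    intro ε hε
    obtain ⟨N, hN⟩ := exists_pow_lt_of_lt_one (show 0 < ε/2 by positivity)
      (show (1/2:ℝ) < 1 by norm_num)
    obtain ⟨n, ⟨α, hα, h1, h2⟩, hn⟩ := Set.Infinite.exists_gt hinf N
    refine ⟨f α, hα, ?_⟩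
    have h3 := hd α k
    rw [h1, dist_comm] at h3
    have h4 : N ≤ nodeSeq α (k+1) := by
      simp only [nodeSeq]
      have := Nat.right_le_pair (nodeSeq α k) (α k)
      omega
    have h5 : (1/2:ℝ)^(nodeSeq α (k+1)) ≤ (1/2)^N :=
      pow_le_pow_of_le_one (by norm_num) (by norm_num) h4
    linarith
  have hT := hF.preimage hf
  have heq : f ⁻¹' F = (f ⁻¹' F ∩ ⋂ k, {α | nodeSeq α k ≠ v}) ∪
      ⋃ k, ⋃ n, (f ⁻¹' F ∩ {α | nodeSeq α k = v ∧ α k = n}) := by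
    ext α
    simp only [mem_union, mem_inter_iff, mem_iInter, mem_iUnion, mem_ofPred_eq]
    constructor
    · intro h
      by_cases h' : ∀ k, nodeSeq α k ≠ v
      · exact Or.inl ⟨h, h'⟩
      · push Not at h'
        obtain ⟨k, hk⟩ := h'
        exact Or.inr ⟨k, α k, h, hk, rfl⟩
    · rintro (h | ⟨k, n, h, -⟩)
      exacts [h.1, h]
  have hA : IsCompact (f ⁻¹' F ∩ ⋂ k, {α | nodeSeq α k ≠ v}) := by
    apply isCompact_of_finBranch
    · refine hT.inter (isClosed_iInter fun k => ?_)
      exact (isClosed_discrete {v}ᶜ).preimage (nodeSeq_continuous k)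
    · intro k w
      by_cases hw : w = v
      · convert finite_empty
        ext n
        simp only [mem_ofPred_eq, mem_empty_iff_false, iff_false]
        rintro ⟨α, hα, h1, -⟩
        exact mem_iInter.1 hα.2 k (h1.trans hw)
      · refine (hbr k w hw).subset ?_
        rintro n ⟨α, hα, h⟩
        exact ⟨α, hα.1, h⟩
  have hB : ∀ k n, IsCompact (f ⁻¹' F ∩ {α | nodeSeq α k = v ∧ α k = n}) := by
    intro k0 n0
    apply isCompact_of_finBranch
    · refine hT.inter (IsClosed.inter (s₁ := {α | nodeSeq α k0 = v}) (s₂ := {α : ℕ → ℕ | α k0 = n0}) ?_ ?_)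
      · exact (isClosed_discrete {v}).preimage (nodeSeq_continuous k0)
      · exact isClosed_eq (continuous_apply k0) continuous_const
    · intro k w
      by_cases hw : w = v
      · refine (finite_singleton n0).subset ?_
        rintro n ⟨α, hα, h1, rfl⟩
        have : k = k0 := (nodeSeq_strictMono α).injective ((h1.trans hw).trans hα.2.1.symm)
        subst this
        exact hα.2.2
      · refine (hbr k w hw).subset ?_
        rintro n ⟨α, hα, h⟩
        exact ⟨α, hα.1, h⟩
  rw [heq, union_eq_iUnion]
  refine isSigmaCompact_iUnion _ fun b => ?_
  cases b
  · exact isSigmaCompact_iUnion _ fun k => isSigmaCompact_iUnion _ fun n =>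
      (hB k n).isSigmaCompact
  · exact hA.isSigmaCompact

lemma exists_baire_coloring {X ι : Type*} [MetricSpace X] [CompleteSpace X]
    [SecondCountableTopology X] (c : X → ι) (hc : ∀ i, IsFsigma (c ⁻¹' {i}))
    (hun : ¬ (range c).Countable) :
    ∃ e : (ℕ → ℕ) → ι × (ℕ × List ℕ), ∀ j, IsCompact (e ⁻¹' {j}) := by
  obtain ⟨y, hinj, hy⟩ := exists_tree_points c hun
  obtain ⟨f, hf, hd⟩ := exists_baire_map y hy
  have hsc : ∀ i, IsSigmaCompact (f ⁻¹' (c ⁻¹' {i})) := by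
    intro i
    obtain ⟨F, hFc, hF⟩ := hc i
    rw [hF, preimage_iUnion]
    refine isSigmaCompact_iUnion _ fun m => ?_
    have hFi : ∀ x ∈ F m, c x = i := by
      intro x hx
      have : x ∈ c ⁻¹' {i} := by rw [hF]; exact mem_iUnion.2 ⟨m, hx⟩
      exact this
    by_cases hex : ∃ v, y v ∈ F m
    · obtain ⟨v, hv⟩ := hex
      refine preimage_sigmaCompact y f hf hd _ (hFc m) v fun w hw hwF => hw ?_
      exact hinj ((hFi _ hwF).trans (hFi _ hv).symm)
    · exact preimage_sigmaCompact y f hf hd _ (hFc m) 0 fun w _ hwF => hex ⟨w, hwF⟩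
  choose g hg using fun i => exists_disjointify _ (hsc i)
  refine ⟨fun α => (c (f α), g (c (f α)) α), fun j => ?_⟩
  convert hg j.1 j.2 using 1
  ext α
  obtain ⟨j1, j2⟩ := j
  simp only [mem_preimage, mem_singleton_iff, Prod.mk.injEq, mem_ofPred_eq]
  constructor
  · rintro ⟨h1, h2⟩
    rw [h1] at h2
    exact ⟨h1, h2⟩
  · rintro ⟨h1, h2⟩
    rw [h1]
    exact ⟨rfl, h2⟩

lemma fsigma_to_compact (X : Type u) [TopologicalSpace X] [PolishSpace X]
    (κ : Cardinal.{u}) (hκ : ℵ₀ < κ)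
    (h : HasPartitionInto κ (fun s : Set X => IsFsigma s)) :
    HasPartitionInto κ (fun s : Set X => IsCompact s) := by
  let _ := TopologicalSpace.upgradeIsCompletelyMetrizable X
  obtain ⟨P, hne, hfs, hdis, hcov, hcard⟩ := h
  have hex : ∀ x : X, ∃ p : P, x ∈ p.1 := by
    intro x
    have : x ∈ ⋃₀ P := hcov ▸ mem_univ x
    obtain ⟨p, hp, hx⟩ := this
    exact ⟨⟨p, hp⟩, hx⟩
  choose c hc using hex
  have hcp : ∀ (p : P) x, x ∈ p.1 → c x = p := by
    intro p x hx
    by_contra hcon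
    exact disjoint_left.1 (hdis (c x).2 p.2 (fun h => hcon (Subtype.ext h))) (hc x) hx
  have hfib : ∀ p : P, c ⁻¹' {p} = p.1 := by
    intro p
    ext x
    exact ⟨fun h => by rw [← show c x = p from h]; exact hc x, hcp p x⟩
  have hF : ∀ p : P, IsFsigma (c ⁻¹' {p}) := fun p => by rw [hfib]; exact hfs _ p.2
  choose pt hpt using fun p : P => hne p.1 p.2
  have hcpt : ∀ p, c (pt p) = p := fun p => hcp p _ (hpt p)
  have hun : ¬ (range c).Countable := by
    intro hcount
    have hs : range c = Set.univ := range_eq_univ.2 fun p => ⟨pt p, hcpt p⟩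
    rw [hs, Set.countable_univ_iff, ← Cardinal.mk_le_aleph0_iff, hcard] at hcount
    exact absurd hcount (not_le.2 hκ)
  have hX : Nonempty X := by
    by_contra hX
    rw [not_nonempty_iff] at hX
    exact hun (by rw [range_eq_empty]; exact countable_empty)
  obtain ⟨e, he⟩ := exists_baire_coloring c hF hun
  obtain ⟨a, ha⟩ := exists_coding c hF
  let C : X → P × (P × (ℕ × List ℕ)) := fun x => (c x, e (a x))
  have hC : ∀ j, IsCompact (C ⁻¹' {j}) := by
    intro j
    have hj : C ⁻¹' {j} = {x | c x = j.1 ∧ a x ∈ e ⁻¹' {j.2}} := by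
      ext x
      exact Prod.ext_iff
    rw [hj]
    exact ha j.1 _ (he j.2)
  refine ⟨range fun x => C ⁻¹' {C x}, ?_, ?_, ?_, ?_, ?_⟩
  · rintro _ ⟨x, rfl⟩
    exact ⟨x, rfl⟩
  · rintro _ ⟨x, rfl⟩
    exact hC _
  · rintro _ ⟨x, rfl⟩ _ ⟨z, rfl⟩ hxz
    refine disjoint_left.2 fun w hw hw' => hxz ?_
    have h1 : C w = C x := hw
    have h2 : C w = C z := hw'
    simp only [← h1, ← h2]
  · refine eq_univ_of_forall fun x => ?_
    exact ⟨_, ⟨x, rfl⟩, rfl⟩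
  · apply le_antisymm
    · have hsub : (range fun x => C ⁻¹' {C x}) ⊆ range fun j => C ⁻¹' {j} := by
        rintro _ ⟨x, rfl⟩
        exact ⟨C x, rfl⟩
      refine (Cardinal.mk_le_mk_of_subset hsub).trans (Cardinal.mk_range_le.trans ?_)
      have hctb : #(ULift.{u} (ℕ × List ℕ)) ≤ ℵ₀ := Cardinal.mk_le_aleph0
      simp only [Cardinal.mk_prod, hcard, Cardinal.lift_id, Cardinal.mk_uLift,
        Cardinal.lift_mul] at hctb ⊢
      simp
      have := hκ.le
      simp [Cardinal.mul_eq_self this, Cardinal.mul_aleph0_eq this]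
    · rw [← hcard]
      refine Cardinal.mk_le_of_injective
        (f := fun p : P => (⟨C ⁻¹' {C (pt p)}, pt p, rfl⟩ : range fun x => C ⁻¹' {C x})) ?_
      intro p q hpq
      have h1 : C ⁻¹' {C (pt p)} = C ⁻¹' {C (pt q)} := congrArg Subtype.val hpq
      have h2 : pt p ∈ C ⁻¹' {C (pt q)} := h1 ▸ rfl
      have h3 : c (pt p) = c (pt q) := congrArg Prod.fst h2
      rwa [hcpt, hcpt] at h3

end Helpers

/-- For an uncountable Polish space `X` and an uncountable cardinal `κ`, the
following are equivalent: `X` admits a partition into exactly `κ` nonempty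
compact sets; into exactly `κ` nonempty closed sets; into exactly `κ` nonempty
`Fσ` sets. -/
theorem compact_iff_closed_iff_fsigma_partition
    (X : Type u) [TopologicalSpace X] [PolishSpace X] [Uncountable X]
    (κ : Cardinal.{u}) (hκ : ℵ₀ < κ) :
    (HasPartitionInto κ (fun s : Set X => IsCompact s) ↔
      HasPartitionInto κ (fun s : Set X => IsClosed s)) ∧
    (HasPartitionInto κ (fun s : Set X => IsClosed s) ↔
      HasPartitionInto κ (fun s : Set X => IsFsigma s)) := by
  have hcc : HasPartitionInto κ (fun s : Set X => IsCompact s) →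
      HasPartitionInto κ (fun s : Set X => IsClosed s) := by
    rintro ⟨P, h1, h2, h3⟩
    exact ⟨P, h1, fun s hs => (h2 s hs).isClosed, h3⟩
  have hcf : HasPartitionInto κ (fun s : Set X => IsClosed s) →
      HasPartitionInto κ (fun s : Set X => IsFsigma s) := by
    rintro ⟨P, h1, h2, h3⟩
    exact ⟨P, h1, fun s hs => ⟨fun _ => s, fun _ => h2 s hs, (Set.iUnion_const s).symm⟩, h3⟩
  have hfc := fsigma_to_compact X κ hκ
  exact ⟨⟨hcc, fun h => hfc (hcf h)⟩, hcf, fun h => hcc (hfc h)⟩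
end

section
/- Let S be the set of all cardinals μ such that the Cantor space 2^ω admits a partition into exactly μ nonempty Borel sets. Then S is closed under singular limits: for every singular cardinal κ, if S ∩ κ is unbounded in κ (i.e., for every cardinal λ < κ there is μ ∈ S with λ ≤ μ < κ), then κ ∈ S. -/
open Cardinal MeasureTheory

/-- The set of cardinals `μ` such that the Cantor space `2^ω` admits a partition
into exactly `μ` nonempty Borel sets. -/
def cantorBorelPartitionSpectrum : Set Cardinal :=
  {μ | ∃ P : Set (Set (ℕ → Bool)),
    (∀ s ∈ P, s.Nonempty) ∧
    (∀ s ∈ P, MeasurableSet[borel (ℕ → Bool)] s) ∧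
    P.PairwiseDisjoint id ∧
    ⋃₀ P = Set.univ ∧
    #P = μ}

theorem spectrum_sum_mem (P : Set (Set (ℕ → Bool)))
    (h1 : ∀ s ∈ P, s.Nonempty) (h2 : ∀ s ∈ P, MeasurableSet[borel (ℕ → Bool)] s)
    (h3 : P.PairwiseDisjoint id) (h4 : ⋃₀ P = Set.univ)
    (m : P → Cardinal) (hm : ∀ p, m p ∈ cantorBorelPartitionSpectrum) :
    Cardinal.sum m ∈ cantorBorelPartitionSpectrum := by
  choose Q q1 q2 q3 q4 q5 using hm
  let e : (ℕ → Bool) → (ℕ → Bool) := fun x n => x (2 * n)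
  let o : (ℕ → Bool) → (ℕ → Bool) := fun x n => x (2 * n + 1)
  have he : Continuous e := by fun_prop
  have ho : Continuous o := by fun_prop
  have hsurj : ∀ y z, ∃ x, e x = y ∧ o x = z := by
    intro y z
    refine ⟨fun n => if n % 2 = 0 then y (n / 2) else z (n / 2), ?_, ?_⟩
    · funext n
      simp [e]
    · funext n
      have h : (2 * n + 1) / 2 = n := by omega
      simp [o, h]
  let F : (Σ p : P, Q p) → Set (ℕ → Bool) := fun a => e ⁻¹' a.1.1 ∩ o ⁻¹' a.2.1
  have Fne : ∀ a, (F a).Nonempty := by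
    rintro ⟨⟨s, hs⟩, ⟨t, ht⟩⟩
    obtain ⟨y, hy⟩ := h1 s hs
    obtain ⟨z, hz⟩ := q1 _ t ht
    obtain ⟨x, hx, hx'⟩ := hsurj y z
    exact ⟨x, by simpa [F, hx, hx'] using ⟨hy, hz⟩⟩
  have Fdisj : ∀ a b x, x ∈ F a → x ∈ F b → a = b := by
    rintro ⟨⟨s, hs⟩, ⟨t, ht⟩⟩ ⟨⟨s', hs'⟩, ⟨t', ht'⟩⟩ x ⟨hx1, hx2⟩ ⟨hx3, hx4⟩
    obtain rfl : s = s' := h3.elim_set hs hs' (e x) hx1 hx3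
    obtain rfl : t = t' := (q3 _).elim_set ht ht' (o x) hx2 hx4
    rfl
  have Finj : Function.Injective F := by
    intro a b hab
    obtain ⟨x, hx⟩ := Fne a
    exact Fdisj a b x hx (hab ▸ hx)
  refine ⟨Set.range F, ?_, ?_, ?_, ?_, ?_⟩
  · rintro _ ⟨a, rfl⟩
    exact Fne a
  · rintro _ ⟨⟨⟨s, hs⟩, ⟨t, ht⟩⟩, rfl⟩
    letI : MeasurableSpace (ℕ → Bool) := borel _
    haveI : BorelSpace (ℕ → Bool) := ⟨rfl⟩
    exact (he.measurable (h2 s hs)).inter (ho.measurable (q2 _ t ht))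
  · rintro _ ⟨a, rfl⟩ _ ⟨b, rfl⟩ hab
    refine Set.disjoint_left.2 fun x hx hx' => hab ?_
    rw [Fdisj a b x hx hx']
  · refine Set.eq_univ_of_forall fun x => ?_
    obtain ⟨s, hs, hxs⟩ : e x ∈ ⋃₀ P := h4 ▸ Set.mem_univ _
    obtain ⟨t, ht, hxt⟩ : o x ∈ ⋃₀ Q ⟨s, hs⟩ := q4 ⟨s, hs⟩ ▸ Set.mem_univ _
    exact ⟨_, ⟨⟨⟨s, hs⟩, ⟨t, ht⟩⟩, rfl⟩, hxs, hxt⟩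
  · rw [Cardinal.mk_range_eq F Finj, Cardinal.mk_sigma]
    congr 1
    funext p
    exact q5 p

/-- The set of sizes of partitions of the Cantor space into Borel sets is closed
under singular limits: if `κ` is singular (infinite with `cof κ.ord < κ`) and the
spectrum is unbounded in `κ`, then `κ` belongs to the spectrum. -/
theorem cantorBorelPartitionSpectrum_closed_under_singular_limits
    (κ : Cardinal) (hinf : ℵ₀ ≤ κ) (hsing : κ.ord.cof < κ)
    (hub : ∀ l : Cardinal, l < κ →
      ∃ μ ∈ cantorBorelPartitionSpectrum, l ≤ μ ∧ μ < κ) :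
    κ ∈ cantorBorelPartitionSpectrum := by
  obtain ⟨A, hA, hAc⟩ := Order.exists_cof_eq κ.ord.ToType
  rw [Ordinal.cof_toType] at hAc
  have hI : ∀ a : κ.ord.ToType, #(Set.Iic a) < κ := by
    intro a
    have := Cardinal.mk_Iic_lt a (by simp) (by simpa using hinf)
    simpa using this
  choose m hm hm1 hm2 using fun a : A => hub _ (hI a)
  obtain ⟨μ, ⟨P, h1, h2, h3, h4, h5⟩, hμ1, hμ2⟩ := hub _ hsing
  have hAP : #A ≤ #P := by rw [hAc, h5]; exact hμ1
  have hne : Nonempty A := by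
    rw [← Cardinal.mk_ne_zero_iff, hAc, Ne, Ordinal.cof_eq_zero]
    intro h
    rw [Cardinal.ord_eq_zero] at h
    exact absurd (Cardinal.aleph0_pos.trans_le hinf) (by simp [h])
  obtain ⟨g⟩ := hAP
  let f : P → A := Function.invFun g
  have hfg : ∀ a, f (g a) = a := Function.leftInverse_invFun g.injective
  have key := spectrum_sum_mem P h1 h2 h3 h4 (fun p => m (f p)) (fun p => hm _)
  suffices h : Cardinal.sum (fun p => m (f p)) = κ by rwa [h] at key
  apply le_antisymm
  · calc Cardinal.sum (fun p => m (f p)) ≤ Cardinal.sum (fun _ : P => κ) :=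
          Cardinal.sum_le_sum _ _ fun p => (hm2 _).le
      _ = #P * κ := by simp
      _ ≤ κ * κ := by gcongr; rw [h5]; exact hμ2.le
      _ = κ := Cardinal.mul_eq_self hinf
  · have hsurj : Function.Surjective
        (fun x : (Σ a : A, Set.Iic (a : κ.ord.ToType)) => (x.2 : κ.ord.ToType)) := by
      intro x
      obtain ⟨a, ha, hxa⟩ := hA x
      exact ⟨⟨⟨a, ha⟩, ⟨x, hxa⟩⟩, rfl⟩
    calc κ = #κ.ord.ToType := by simp
      _ ≤ #(Σ a : A, Set.Iic (a : κ.ord.ToType)) := Cardinal.mk_le_of_surjective hsurj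
      _ = Cardinal.sum (fun a : A => #(Set.Iic (a : κ.ord.ToType))) := Cardinal.mk_sigma _
      _ ≤ Cardinal.sum m := Cardinal.sum_le_sum _ _ hm1
      _ ≤ Cardinal.sum (fun p => m (f p)) := by
        change #(Σ a : A, (m a).out) ≤ #(Σ p : P, (m (f p)).out)
        refine Cardinal.mk_le_of_surjective (f := fun x => ⟨f x.1, x.2⟩) ?_
        rintro ⟨a, y⟩
        obtain ⟨p, rfl⟩ : ∃ p, f p = a := ⟨_, hfg a⟩
        exact ⟨⟨p, y⟩, rfl⟩
end

section
/- Every partition of the real line ℝ into at least two nonempty closed sets is uncountable: if P is a family of pairwise disjoint nonempty closed subsets of ℝ with union ℝ and P has at least two members, then P is uncountable. -/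
/-- Sierpiński: every partition of the real line into at least two nonempty
closed sets is uncountable. -/
theorem partition_of_real_into_closed_sets_uncountable
    (P : Set (Set ℝ))
    (hne : ∀ s ∈ P, s.Nonempty)
    (hcl : ∀ s ∈ P, IsClosed s)
    (hdisj : P.PairwiseDisjoint id)
    (hcov : ⋃₀ P = Set.univ)
    (h2 : P.Nontrivial) :
    ¬ P.Countable := by
  intro hc
  have huniq : ∀ s ∈ P, ∀ t ∈ P, ∀ x, x ∈ s → x ∈ t → s = t := by
    intro s hs t ht x hxs hxt
    by_contra h
    exact Set.disjoint_left.1 (hdisj hs ht h) hxs hxt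
  have hex : ∀ x : ℝ, ∃ s ∈ P, x ∈ s := by
    intro x
    have : x ∈ ⋃₀ P := by rw [hcov]; trivial
    simpa using this
  let B : Set ℝ := (⋃ s ∈ P, interior s)ᶜ
  have hB : IsClosed B :=
    (isOpen_biUnion fun s _ => isOpen_interior).isClosed_compl
  have hfr : ∀ t ∈ P, frontier t ⊆ B := by
    intro t ht z hz hz'
    simp only [Set.mem_iUnion] at hz'
    obtain ⟨s, hs, hzs⟩ := hz'
    have := huniq s hs t ht z (interior_subset hzs) ((hcl t ht).frontier_subset hz)
    subst this
    exact hz.2 hzs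
  have hBne : B.Nonempty := by
    obtain ⟨s, hs, t, ht, hst⟩ := h2
    have : (frontier s).Nonempty := by
      rw [nonempty_frontier_iff]
      refine ⟨hne s hs, fun h => ?_⟩
      obtain ⟨y, hy⟩ := hne t ht
      exact hst (huniq s hs t ht y (h ▸ Set.mem_univ y) hy)
    exact this.mono (hfr s hs)
  have : Countable P := hc.to_subtype
  have : Nonempty B := hBne.to_subtype
  have : CompleteSpace B := hB.completeSpace_coe
  obtain ⟨⟨s, hs⟩, ⟨x, hxB⟩, hx⟩ := nonempty_interior_of_iUnion_of_closed
    (f := fun s : P => ((↑) : B → ℝ) ⁻¹' s.1)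
    (fun s => (hcl s.1 s.2).preimage continuous_subtype_val)
    (by
      ext x
      obtain ⟨s, hs, hxs⟩ := hex x
      simp only [Set.mem_iUnion, Set.mem_univ, iff_true]
      exact ⟨⟨s, hs⟩, hxs⟩)
  rw [mem_interior_iff_mem_nhds, Metric.mem_nhds_iff] at hx
  obtain ⟨ε, hε, hball⟩ := hx
  have key : ∀ z ∈ Metric.ball x ε, z ∈ B → z ∈ s := fun z hz hzB =>
    hball (show (⟨z, hzB⟩ : B) ∈ Metric.ball (⟨x, hxB⟩ : B) ε from hz)
  have hxs : x ∈ s := key x (Metric.mem_ball_self hε) hxB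
  have hsub : Metric.ball x ε ⊆ s := by
    intro y hy
    by_contra hys
    obtain ⟨t, ht, hyt⟩ := hex y
    have hxt : x ∉ t := fun h => hys (huniq s hs t ht x hxs h ▸ hyt)
    obtain ⟨z, hz, hzt⟩ : ∃ z, z ∈ Metric.ball x ε ∧ z ∈ frontier t := by
      by_contra hno
      push Not at hno
      have hint : ∀ z ∈ Metric.ball x ε, z ∈ t → z ∈ interior t := by
        intro z hz hzt
        by_contra h
        exact hno z hz ⟨subset_closure hzt, h⟩
      obtain ⟨z, -, hz1, hz2⟩ := (convex_ball x ε).isPreconnected (interior t) tᶜ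
        isOpen_interior (hcl t ht).isOpen_compl
        (fun z hz => (em (z ∈ t)).imp (hint z hz) id)
        ⟨y, hy, hint y hy hyt⟩ ⟨x, Metric.mem_ball_self hε, hxt⟩
      exact hz2 (interior_subset hz1)
    have := huniq s hs t ht z (key z hz (hfr t ht hzt)) ((hcl t ht).frontier_subset hzt)
    exact hxt (this ▸ hxs)
  apply hxB
  simp only [Set.mem_iUnion]
  exact ⟨s, hs, mem_interior.2 ⟨_, hsub, Metric.isOpen_ball, Metric.mem_ball_self hε⟩⟩
end

section
/- There exists a strictly increasing transfinite sequence (E_ξ)_{ξ < ω₁}, indexed by the countable ordinals, of G_δ subsets of the Cantor space 2^ω (so E_ξ ⊆ E_η and E_ξ ≠ E_η whenever ξ < η < ω₁) whose union is all of 2^ω. -/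
open Cardinal

namespace HausGap

open Set

theorem exists_rec {I : Type*} [LinearOrder I] [WellFoundedLT I] {X : Type*} [Inhabited X]
    (Q : I → (I → X) → X → Prop)
    (hcongr : ∀ i f g x, (∀ j < i, f j = g j) → Q i f x → Q i g x)
    (hstep : ∀ i f, (∀ j < i, Q j f (f j)) → ∃ x, Q i f x) :
    ∃ f : I → X, ∀ i, Q i f (f i) := by
  classical
  let ext : (i : I) → ((j : I) → j < i → X) → I → X :=
    fun i r j => if h : j < i then r j h else default
  let F : (i : I) → ((j : I) → j < i → X) → X :=
    fun i r => if h : ∃ x, Q i (ext i r) x then h.choose else default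
  let f : I → X := (wellFounded_lt (α := I)).fix F
  have hf : ∀ i, f i = F i (fun j _ => f j) := fun i => WellFounded.fix_eq _ F i
  refine ⟨f, fun i => ?_⟩
  induction i using WellFoundedLT.induction with
  | ind i ih =>
    have hag : ∀ j < i, f j = ext i (fun j _ => f j) j := by
      intro j hj
      simp [ext, hj]
    obtain ⟨x, hx⟩ := hstep i f ih
    have hex : ∃ x, Q i (ext i (fun j _ => f j)) x := ⟨x, hcongr _ _ _ _ hag hx⟩
    have h1 := hex.choose_spec
    have h2 : f i = hex.choose := by
      rw [hf]
      simp only [F]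
      rw [dif_pos hex]
    rw [h2]
    exact hcongr _ _ _ _ (fun j hj => (hag j hj).symm) h1

def Good {I : Type*} [LinearOrder I] (A B : I → Set ℕ) (i : I) (a b : Set ℕ) : Prop :=
  Disjoint a b ∧ (a ∪ b)ᶜ.Infinite ∧
  (∀ j < i, (A j \ a).Finite ∧ (B j \ b).Finite ∧ (b \ B j).Infinite) ∧
  ∀ n : ℕ, {j | j < i ∧ a ∩ B j ⊆ Iio n}.Finite

theorem cofinal_seq {I : Type*} [LinearOrder I] (i : I) (hc : (Iio i).Countable)
    (hne : (Iio i).Nonempty) :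
    ∃ β : ℕ → I, Monotone β ∧ (∀ k, β k < i) ∧ ∀ j < i, ∃ k, j ≤ β k := by
  obtain ⟨e, he⟩ := hc.exists_eq_range hne
  have hlt : ∀ k, e k < i := fun k => by
    have : e k ∈ Iio i := he ▸ mem_range_self k
    exact this
  refine ⟨partialSups e, (partialSups e).monotone, fun k => ?_, fun j hj => ?_⟩
  · induction k with
    | zero => simpa using hlt 0
    | succ k ih =>
      rw [partialSups_add_one]
      exact max_lt ih (hlt _)
  · have : j ∈ range e := he ▸ hj
    obtain ⟨k, rfl⟩ := this
    exact ⟨k, le_partialSups e k⟩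

theorem step {I : Type*} [LinearOrder I] (A B : I → Set ℕ) (i : I) (hc : (Iio i).Countable)
    (h : ∀ j < i, Good A B j (A j) (B j)) : ∃ a b, Good A B i a b := by
  classical
  rcases (Iio i).eq_empty_or_nonempty with hemp | hne
  · have hno : ∀ j, ¬ j < i := fun j hj => by
      have : j ∈ Iio i := hj
      simp [hemp] at this
    refine ⟨∅, ∅, by simp, by simpa using infinite_univ, fun j hj => absurd hj (hno j), fun n => ?_⟩
    have : {j | j < i ∧ ∅ ∩ B j ⊆ Iio n} = ∅ := by
      ext j; simp [hno j]
    rw [this]; exact finite_empty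
  obtain ⟨β, βmono, βlt, βcof⟩ := cofinal_seq i hc hne
  have hA : ∀ j j', j ≤ j' → j' < i → (A j \ A j').Finite := by
    intro j j' hjj hj'
    rcases hjj.eq_or_lt with rfl | hlt
    · simp
    · exact ((h j' hj').2.2.1 j hlt).1
  have hB : ∀ j j', j ≤ j' → j' < i → (B j \ B j').Finite := by
    intro j j' hjj hj'
    rcases hjj.eq_or_lt with rfl | hlt
    · simp
    · exact ((h j' hj').2.2.1 j hlt).2.1
  have hAB : ∀ j j', j < i → j' < i → (A j ∩ B j').Finite := by
    intro j j' hj hj'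
    have hm : max j j' < i := max_lt hj hj'
    refine ((hA j _ (le_max_left j j') hm).union (hB j' _ (le_max_right j j') hm)).subset ?_
    rintro x ⟨hx1, hx2⟩
    have hd : x ∈ A (max j j') → x ∉ B (max j j') := fun hh => disjoint_left.1 (h _ hm).1 hh
    by_cases hx : x ∈ A (max j j')
    · exact Or.inr ⟨hx2, hd hx⟩
    · exact Or.inl ⟨hx1, hx⟩
  have hfinB : ∀ S : Set ℕ, (∀ k, (S ∩ B (β k)).Finite) → ∀ j < i, (S ∩ B j).Finite := by
    intro S hS j hj
    obtain ⟨k, hk⟩ := βcof j hj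
    refine ((hS k).union (hB j (β k) hk (βlt k))).subset ?_
    rintro x ⟨hx1, hx2⟩
    by_cases hx : x ∈ B (β k)
    · exact Or.inl ⟨hx1, hx⟩
    · exact Or.inr ⟨hx2, hx⟩
  -- the sequence of reserved points
  obtain ⟨φ, φmono, hφ⟩ : ∃ φ : ℕ → ℕ, StrictMono φ ∧
      ∀ n, ∀ j ≤ n, φ n ∉ A (β j) ∧ φ n ∉ B (β j) := by
    refine Filter.extraction_forall_of_frequently
      (P := fun n m => ∀ j ≤ n, m ∉ A (β j) ∧ m ∉ B (β j)) fun n => ?_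
    rw [Nat.frequently_atTop_iff_infinite]
    have hfin : (⋃ j ∈ Iic n, ((A (β j) \ A (β n)) ∪ (B (β j) \ B (β n)))).Finite := by
      refine (finite_Iic n).biUnion fun j hj => ?_
      exact (hA _ _ (βmono hj) (βlt n)).union (hB _ _ (βmono hj) (βlt n))
    refine ((h (β n) (βlt n)).2.1.diff hfin).mono ?_
    rintro x ⟨hx1, hx2⟩ j hj
    simp only [mem_compl_iff, mem_union, not_or] at hx1
    simp only [mem_iUnion, not_exists] at hx2
    have := hx2 j hj
    simp only [mem_union, mem_diff, not_or, not_and, not_not] at this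
    exact ⟨fun hh => hx1.1 (this.1 hh), fun hh => hx1.2 (this.2 hh)⟩
  set Q : Set ℕ := range φ with hQ
  have hQA : ∀ k, (Q ∩ A (β k)).Finite := by
    intro k
    refine ((finite_Iio k).image φ).subset ?_
    rintro x ⟨⟨n, rfl⟩, hx⟩
    refine ⟨n, ?_, rfl⟩
    by_contra hn
    exact (hφ n k (not_lt.1 hn)).1 hx
  have hQB : ∀ j < i, (Q ∩ B j).Finite := by
    refine hfinB Q fun k => ?_
    refine ((finite_Iio k).image φ).subset ?_
    rintro x ⟨⟨n, rfl⟩, hx⟩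
    refine ⟨n, ?_, rfl⟩
    by_contra hn
    exact (hφ n k (not_lt.1 hn)).2 hx
  -- the interpolant
  set c : Set ℕ := {m | m ∉ Q ∧ ∃ k, m ∈ A (β k) ∧ ∀ j ≤ k, m ∉ B (β j)} with hcdef
  have hcB : ∀ j < i, (c ∩ B j).Finite := by
    refine hfinB c fun k => ?_
    have hfin : (⋃ l ∈ Iio k, (A (β l) ∩ B (β k))).Finite :=
      (finite_Iio k).biUnion fun l _ => hAB _ _ (βlt l) (βlt k)
    refine hfin.subset ?_
    rintro x ⟨⟨_, l, hl, hl'⟩, hx⟩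
    simp only [mem_iUnion]
    refine ⟨l, ?_, hl, hx⟩
    by_contra hn
    exact hl' k (not_lt.1 hn) hx
  have hAc : ∀ j < i, (A j \ c).Finite := by
    intro j hj
    obtain ⟨k, hk⟩ := βcof j hj
    have hfin : (⋃ l ∈ Iic k, (A (β k) ∩ B (β l))).Finite :=
      (finite_Iic k).biUnion fun l _ => hAB _ _ (βlt k) (βlt l)
    refine (((hA j (β k) hk (βlt k)).union (hQA k)).union hfin).subset ?_
    rintro x ⟨hx1, hx2⟩
    by_cases hxk : x ∈ A (β k)
    · by_cases hxQ : x ∈ Q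
      · exact Or.inl (Or.inr ⟨hxQ, hxk⟩)
      · right
        by_contra hno
        simp only [mem_iUnion, not_exists] at hno
        exact hx2 ⟨hxQ, k, hxk, fun l hl hh => hno l hl ⟨hxk, hh⟩⟩
    · exact Or.inl (Or.inl ⟨hx1, hxk⟩)
  have hI : ∀ z < i, ∀ n : ℕ, {x | x ≤ z ∧ c ∩ B x ⊆ Iio n}.Finite := by
    intro z hz n
    obtain ⟨m, hm⟩ := (hAc z hz).bddAbove
    refine (((h z hz).2.2.2 (max n (m+1))).insert z).subset ?_
    rintro x ⟨hxz, hx⟩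
    rcases hxz.eq_or_lt with rfl | hlt
    · exact mem_insert _ _
    · refine Or.inr ⟨hlt, ?_⟩
      rintro y ⟨hy1, hy2⟩
      simp only [mem_Iio, lt_max_iff]
      by_cases hyc : y ∈ c
      · exact Or.inl (hx ⟨hyc, hy2⟩)
      · exact Or.inr (Nat.lt_succ_of_le (hm ⟨hy1, hyc⟩))
  have hp : ∀ (k : ℕ) (x : I), ∃ p : ℕ, β k < x → x < i →
      p ∈ B x ∧ k ≤ p ∧ p ∉ Q ∧ ∀ j ≤ k, p ∉ B (β j) := by
    intro k x
    by_cases hx : β k < x ∧ x < i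
    · have hfin : (⋃ j ∈ Iic k, (B (β j) \ B (β k))).Finite :=
        (finite_Iic k).biUnion fun j hj => hB _ _ (βmono hj) (βlt k)
      have hinf := ((((h x hx.2).2.2.1 _ hx.1).2.2.diff hfin).diff (hQB x hx.2)).diff (finite_Iio k)
      obtain ⟨p, ⟨⟨⟨hp1, hp2⟩, hp3⟩, hp4⟩, hp5⟩ := hinf.nonempty
      refine ⟨p, fun _ _ => ⟨hp1, not_lt.1 hp5, fun hq => hp4 ⟨hq, hp1⟩, fun j hj hpj => ?_⟩⟩
      apply hp3
      simp only [mem_iUnion]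
      exact ⟨j, hj, hpj, hp2⟩
    · exact ⟨0, fun h1 h2 => absurd ⟨h1, h2⟩ hx⟩
  choose p hp using hp
  set d : Set ℕ := {m | ∃ k x, β k < x ∧ x ≤ β (k+1) ∧ c ∩ B x ⊆ Iio k ∧ m = p k x} with hd
  have hdQ : ∀ m ∈ d, m ∉ Q := by
    rintro m ⟨k, x, h1, h2, h3, rfl⟩
    exact (hp k x h1 (h2.trans_lt (βlt _))).2.2.1
  have hdB : ∀ j < i, (d ∩ B j).Finite := by
    refine hfinB d fun k => ?_
    have hfin : (⋃ l ∈ Iio k, (p l) '' {x | x ≤ β (l+1) ∧ c ∩ B x ⊆ Iio l}).Finite :=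
      (finite_Iio k).biUnion fun l _ => (hI _ (βlt (l+1)) l).image _
    refine hfin.subset ?_
    rintro m ⟨⟨l, x, h1, h2, h3, rfl⟩, hm⟩
    simp only [mem_iUnion]
    refine ⟨l, ?_, x, ⟨h2, h3⟩, rfl⟩
    by_contra hn
    exact (hp l x h1 (h2.trans_lt (βlt _))).2.2.2 k (not_lt.1 hn) hm
  set Q1 : Set ℕ := range (fun n => φ (2*n+1)) with hQ1
  have hQ1Q : Q1 ⊆ Q := by rintro _ ⟨n, rfl⟩; exact mem_range_self _
  refine ⟨c ∪ d, (c ∪ d ∪ Q1)ᶜ, ?_, ?_, ?_, ?_⟩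
  · exact disjoint_compl_right.mono_left subset_union_left
  · have : Q1.Infinite := infinite_range_of_injective (fun m n hmn => by
      have := φmono.injective hmn; omega)
    refine this.mono ?_
    intro x hx hx'
    rcases hx' with (hx' | hx') | hx'
    · exact hx'.1 (hQ1Q hx)
    · exact hdQ x hx' (hQ1Q hx)
    · exact hx' (Or.inr hx)
  · intro j hj
    refine ⟨(hAc j hj).subset (diff_subset_diff_right subset_union_left), ?_, ?_⟩
    · refine (((hcB j hj).union (hdB j hj)).union (hQB j hj)).subset ?_
      rintro x ⟨hx1, hx2⟩
      rw [mem_compl_iff, not_not] at hx2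
      rcases hx2 with (hx2 | hx2) | hx2
      · exact Or.inl (Or.inl ⟨hx2, hx1⟩)
      · exact Or.inl (Or.inr ⟨hx2, hx1⟩)
      · exact Or.inr ⟨hQ1Q hx2, hx1⟩
    · have h0 : (range (fun n => φ (2*n))).Infinite := infinite_range_of_injective (fun m n hmn => by
        have := φmono.injective hmn; omega)
      refine (h0.diff (hQB j hj)).mono ?_
      rintro _ ⟨⟨n, rfl⟩, hx⟩
      have hq : φ (2*n) ∈ Q := mem_range_self _
      refine ⟨?_, fun hb => hx ⟨hq, hb⟩⟩
      rintro ((hx' | hx') | ⟨m, hm⟩)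
      · exact hx'.1 hq
      · exact hdQ _ hx' hq
      · have := φmono.injective hm
        omega
  · intro n
    refine (hI (β n) (βlt n) n).subset ?_
    rintro x ⟨hx1, hx2⟩
    have hcx : c ∩ B x ⊆ Iio n := (inter_subset_inter_left _ subset_union_left).trans hx2
    refine ⟨?_, hcx⟩
    by_contra hn
    have hex := βcof x hx1
    have hspec := Nat.find_spec hex
    have hnlt : n < Nat.find hex := by
      by_contra hle
      exact hn (hspec.trans (βmono (not_lt.1 hle)))
    obtain ⟨k, hk⟩ : ∃ k, Nat.find hex = k + 1 := ⟨Nat.find hex - 1, by omega⟩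
    rw [hk] at hspec
    have hkx : β k < x := not_le.1 (Nat.find_min hex (m := k) (by omega))
    have hpk := hp k x hkx hx1
    have hmem : p k x ∈ d :=
      ⟨k, x, hkx, hspec, hcx.trans (Iio_subset_Iio (by omega)), rfl⟩
    have : p k x < n := hx2 ⟨Or.inr hmem, hpk.1⟩
    have := hpk.2.1
    omega

theorem exists_gap {I : Type*} [LinearOrder I] [WellFoundedLT I]
    (hc : ∀ i : I, (Iio i).Countable) :
    ∃ A B : I → Set ℕ, ∀ i, Good A B i (A i) (B i) := by
  obtain ⟨f, hf⟩ := exists_rec (I := I) (X := Set ℕ × Set ℕ)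
    (fun i f x => Good (fun j => (f j).1) (fun j => (f j).2) i x.1 x.2) (by
      rintro i f g x hfg ⟨h1, h2, h3, h4⟩
      refine ⟨h1, h2, fun j hj => ?_, fun n => (h4 n).subset ?_⟩
      · have := h3 j hj
        simp only [hfg j hj] at this
        exact this
      · rintro j ⟨hj, hj'⟩
        refine ⟨hj, ?_⟩
        simp only [hfg j hj]
        exact hj') (by
      intro i f h
      obtain ⟨a, b, hab⟩ := step (fun j => (f j).1) (fun j => (f j).2) i (hc i) h
      exact ⟨(a, b), hab⟩)
  exact ⟨_, _, hf⟩

def Fill (a b : Set ℕ) (n : ℕ) : Set (ℕ → Bool) :=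
  {x | ∀ m, n ≤ m → (m ∈ a → x m = true) ∧ (m ∈ b → x m = false)}

theorem isClosed_Fill (a b : Set ℕ) (n : ℕ) : IsClosed (Fill a b n) := by
  have : Fill a b n = ⋂ m, {x : ℕ → Bool | n ≤ m → (m ∈ a → x m = true) ∧ (m ∈ b → x m = false)} := by
    ext x; simp [Fill]
  rw [this]
  refine isClosed_iInter fun m => ?_
  exact IsClosed.preimage (f := fun x : ℕ → Bool => x m) (continuous_apply m)
    (isClosed_discrete {y : Bool | n ≤ m → (m ∈ a → y = true) ∧ (m ∈ b → y = false)})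

theorem main {I : Type*} [LinearOrder I] [WellFoundedLT I]
    (hc : ∀ i : I, (Iio i).Countable) (hu : ¬ (univ : Set I).Countable) :
    ∃ E : I → Set (ℕ → Bool), (∀ i, IsGδ (E i)) ∧ (∀ i j, i < j → E i ⊆ E j ∧ E i ≠ E j) ∧
      ∀ x, ∃ i, x ∈ E i := by
  classical
  obtain ⟨A, B, hAB⟩ := exists_gap hc
  refine ⟨fun i => ⋂ n, (Fill (A i) (B i) n)ᶜ, fun i => ?_, fun i j hij => ⟨?_, ?_⟩, fun x => ?_⟩
  · exact IsGδ.iInter_of_isOpen fun n => (isClosed_Fill _ _ _).isOpen_compl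
  · intro x hx
    simp only [mem_iInter, mem_compl_iff] at hx ⊢
    intro n hn
    obtain ⟨h1, h2, -⟩ := (hAB j).2.2.1 i hij
    obtain ⟨m1, hm1⟩ := h1.bddAbove
    obtain ⟨m2, hm2⟩ := h2.bddAbove
    apply hx (n + m1 + m2 + 1)
    intro m hm
    refine ⟨fun ha => (hn m (by omega)).1 ?_, fun hb => (hn m (by omega)).2 ?_⟩
    · by_contra hno
      have := hm1 ⟨ha, hno⟩
      omega
    · by_contra hno
      have := hm2 ⟨hb, hno⟩
      omega
  · intro heq
    let x : ℕ → Bool := fun m => decide (m ∉ B i)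
    have h1 : x ∉ ⋂ n, (Fill (A i) (B i) n)ᶜ := by
      simp only [mem_iInter, mem_compl_iff, not_forall, not_not]
      refine ⟨0, fun m _ => ⟨fun ha => ?_, fun hb => ?_⟩⟩
      · have := disjoint_left.1 (hAB i).1 ha
        simp [x, this]
      · simp [x, hb]
    apply h1
    simp only at heq
    rw [heq]
    simp only [mem_iInter, mem_compl_iff]
    intro n hn
    obtain ⟨m, ⟨hm1, hm2⟩, hm3⟩ := (((hAB j).2.2.1 i hij).2.2.diff (finite_Iio n)).nonempty
    have := (hn m (not_lt.1 hm3)).2 hm1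
    simp [x, hm2] at this
  · by_contra hno
    simp only [mem_iInter, mem_compl_iff, not_exists, not_forall, not_not] at hno
    have hex : ∃ n, ¬ {i | x ∈ Fill (A i) (B i) n}.Countable := by
      by_contra hall
      push Not at hall
      refine hu ((countable_iUnion hall).mono ?_)
      intro i _
      obtain ⟨n, hn⟩ := hno i
      exact mem_iUnion.2 ⟨n, hn⟩
    obtain ⟨n, hn⟩ := hex
    set S := {i | x ∈ Fill (A i) (B i) n} with hS
    have hinf : S.Infinite := fun hfin => hn hfin.countable
    let e := hinf.natEmbedding
    have hcount : (⋃ k, Iic (e k : I)).Countable := by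
      refine countable_iUnion fun k => ?_
      rw [← Iio_insert]
      exact (hc _).insert _
    obtain ⟨α, hα, hα'⟩ : ∃ α ∈ S, α ∉ ⋃ k, Iic (e k : I) := by
      by_contra hcon
      push Not at hcon
      exact hn (hcount.mono hcon)
    simp only [mem_iUnion, mem_Iic, not_exists, not_le] at hα'
    refine ((infinite_range_of_injective (Subtype.val_injective.comp e.injective)).mono ?_)
      ((hAB α).2.2.2 n)
    rintro _ ⟨k, rfl⟩
    refine ⟨hα' k, ?_⟩
    rintro m ⟨hm1, hm2⟩
    by_contra hmn
    have hmn : n ≤ m := not_lt.1 hmn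
    have h1 := (hα m hmn).1 hm1
    have h2 := ((e k).2 m hmn).2 hm2
    rw [h1] at h2
    exact absurd h2 (by decide)

end HausGap

/-- Hausdorff: there is a strictly increasing transfinite sequence, indexed by
the countable ordinals, of `Gδ` subsets of the Cantor space whose union is all
of `2^ω`. -/
theorem exists_strictly_increasing_Gdelta_sequence_cantor :
    ∃ E : Ordinal.{0} → Set (ℕ → Bool),
      (∀ ξ, ξ < (Cardinal.aleph 1).ord → IsGδ (E ξ)) ∧
      (∀ ξ η, ξ < η → η < (Cardinal.aleph 1).ord → E ξ ⊆ E η ∧ E ξ ≠ E η) ∧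
      (⋃ ξ ∈ Set.Iio (Cardinal.aleph 1).ord, E ξ) = Set.univ := by
  classical
  have hIio : ∀ o : Ordinal.{0}, (Set.Iio o).Countable ↔ o < (Cardinal.aleph 1).ord := by
    intro o
    rw [← Cardinal.le_aleph0_iff_set_countable, Cardinal.mk_Iio_ordinal, Cardinal.lift_le_aleph0,
      Cardinal.lt_ord, ← Order.lt_succ_iff, Cardinal.succ_aleph0]
  obtain ⟨E, h1, h2, h3⟩ := HausGap.main (I := Set.Iio (Cardinal.aleph.{0} 1).ord) (by
      intro i
      have := (hIio i.1).2 i.2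
      exact (this.preimage Subtype.val_injective).mono fun j hj => hj) (by
      intro hcon
      have := (hIio (Cardinal.aleph.{0} 1).ord).1 (by
        have := hcon.image Subtype.val
        rwa [Set.image_univ, Subtype.range_coe] at this)
      exact lt_irrefl _ this)
  refine ⟨fun ξ => if h : ξ < (Cardinal.aleph 1).ord then E ⟨ξ, h⟩ else ∅, ?_, ?_, ?_⟩
  · intro ξ h
    simp only [dif_pos h]
    exact h1 _
  · intro ξ η h h'
    simp only [dif_pos h', dif_pos (h.trans h')]
    exact h2 _ _ h
  · refine Set.eq_univ_of_forall fun x => ?_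
    obtain ⟨i, hi⟩ := h3 x
    simp only [Set.mem_iUnion]
    refine ⟨i.1, i.2, ?_⟩
    have : (i : Ordinal) < (Cardinal.aleph 1).ord := i.2
    simp only [dif_pos this]
    exact hi
end

section
/- There is a partition of the real line ℝ into exactly ℵ₁ nonempty Borel sets: a family of ℵ₁ pairwise disjoint nonempty Borel subsets of ℝ whose union is all of ℝ. -/
open Cardinal

/-- `RK r β n`: the point `n` has rank exactly `β` in the relation `r`. -/
def RK (r : ℕ × ℕ → Bool) (β : Ordinal.{0}) (n : ℕ) : Prop :=
  (∀ m, r (m, n) = true → ∃ γ, ∃ _ : γ < β, RK r γ m) ∧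
  (∀ γ, ∀ _ : γ < β, ∃ m, r (m, n) = true ∧ RK r γ m)
termination_by β

theorem RK_unique (r : ℕ × ℕ → Bool) (β : Ordinal.{0}) :
    ∀ (β' : Ordinal.{0}) (n : ℕ), RK r β n → RK r β' n → β = β' := by
  induction β using WellFoundedLT.induction with
  | ind β ih =>
    intro β' n h h'
    rw [RK] at h h'
    rcases lt_trichotomy β β' with hl | hl | hl
    · obtain ⟨m, hm, h1⟩ := h'.2 β hl
      obtain ⟨γ, hγ, h2⟩ := h.1 m hm
      exact absurd (ih γ hγ β m h2 h1) hγ.ne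
    · exact hl
    · obtain ⟨m, hm, h1⟩ := h.2 β' hl
      obtain ⟨γ, hγ, h2⟩ := h'.1 m hm
      exact absurd (ih β' hl γ m h1 h2) hγ.ne'

theorem countable_Iio_of_lt (α : Ordinal.{0}) (h : α < Ordinal.omega 1) :
    Countable (Set.Iio α) := by
  rw [← Cardinal.mk_le_aleph0_iff, Cardinal.mk_Iio_ordinal]
  have : α.card < aleph 1 := by
    rw [← Cardinal.lt_ord]; simpa using h
  rw [Cardinal.lift_le_aleph0]
  rw [← succ_aleph0] at this
  exact Order.lt_succ_iff.mp this

theorem RK_meas (β : Ordinal.{0}) : β < Ordinal.omega 1 →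
    ∀ n, MeasurableSet {r | RK r β n} := by
  induction β using WellFoundedLT.induction with
  | ind β ih =>
    intro hβ n
    have hc := countable_Iio_of_lt β hβ
    have : {r | RK r β n} =
        (⋂ m : ℕ, ({r | r (m, n) = true}ᶜ ∪ ⋃ γ : Set.Iio β, {r | RK r γ.1 m})) ∩
        (⋂ γ : Set.Iio β, ⋃ m : ℕ, ({r | r (m, n) = true} ∩ {r | RK r γ.1 m})) := by
      ext r
      rw [Set.mem_ofPred_eq, RK]
      simp [imp_iff_not_or]
    rw [this]
    have h1 : ∀ m, MeasurableSet {r : ℕ × ℕ → Bool | r (m, n) = true} := fun m =>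
      measurableSet_eq_fun (measurable_pi_apply (m, n)) measurable_const
    have h2 : ∀ (γ : Set.Iio β) m, MeasurableSet {r | RK r γ.1 m} := fun γ m =>
      ih γ.1 γ.2 (lt_trans γ.2 hβ) m
    refine MeasurableSet.inter ?_ ?_
    · exact MeasurableSet.iInter fun m => (h1 m).compl.union (MeasurableSet.iUnion fun γ => h2 γ m)
    · exact MeasurableSet.iInter fun γ => MeasurableSet.iUnion fun m => (h1 m).inter (h2 γ m)

/-- the fibre over `α` -/
def FB (α : Ordinal.{0}) : Set (ℕ × ℕ → Bool) :=
  {r | (∀ γ : Set.Iio α, ∃ n, RK r γ.1 n) ∧ ¬ ∃ n, RK r α n}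

theorem FB_meas (α : Ordinal.{0}) (h : α < Ordinal.omega 1) : MeasurableSet (FB α) := by
  have hc := countable_Iio_of_lt α h
  have : FB α = (⋂ γ : Set.Iio α, ⋃ n, {r | RK r γ.1 n}) ∩ (⋃ n, {r | RK r α n})ᶜ := by
    ext r
    simp [FB]
  rw [this]
  have h2 : ∀ (γ : Set.Iio α) n, MeasurableSet {r | RK r γ.1 n} := fun γ n =>
    RK_meas γ.1 (lt_trans γ.2 h) n
  exact (MeasurableSet.iInter fun γ => MeasurableSet.iUnion fun n => h2 γ n).inter
    (MeasurableSet.iUnion fun n => RK_meas α h n).compl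

theorem FB_disj (r : ℕ × ℕ → Bool) (α β : Ordinal.{0}) (h : r ∈ FB α) (h' : r ∈ FB β) :
    α = β := by
  rcases lt_trichotomy α β with hl | hl | hl
  · exact absurd (h'.1 ⟨α, hl⟩) h.2
  · exact hl
  · exact absurd (h.1 ⟨β, hl⟩) h'.2

theorem FB_cover (r : ℕ × ℕ → Bool) : ∃ α < Ordinal.omega 1, r ∈ FB α := by
  have hex : ∃ α : Ordinal.{0}, α < Ordinal.omega 1 ∧ ¬ ∃ n, RK r α n := by
    by_contra! hcon
    choose f hf using fun a : Set.Iio (Ordinal.omega.{0} 1) => hcon a.1 a.2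
    have hinj : Function.Injective f := by
      intro a b hab
      exact Subtype.ext (RK_unique r a.1 b.1 (f a) (hf a) (hab ▸ hf b))
    have hc : Countable (Set.Iio (Ordinal.omega.{0} 1)) := hinj.countable
    rw [← Cardinal.mk_le_aleph0_iff, Cardinal.mk_Iio_ordinal, Cardinal.lift_le_aleph0] at hc
    simp at hc
  let S : Set Ordinal.{0} := {α | ¬ ∃ n, RK r α n}
  have hS : S.Nonempty := hex.imp fun _ h => h.2
  obtain ⟨α, hα, hn⟩ := hex
  refine ⟨sInf S, lt_of_le_of_lt (csInf_le' hn) hα, ?_, csInf_mem hS⟩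
  intro γ
  by_contra hγ
  exact absurd (csInf_le' (show γ.1 ∈ S from hγ)) (not_le.mpr γ.2)

open Classical in
theorem FB_nonempty (α : Ordinal.{0}) (h : α < Ordinal.omega 1) : (FB α).Nonempty := by
  have hc := countable_Iio_of_lt α h
  obtain ⟨e, he⟩ := exists_injective_nat (Set.Iio α)
  let r : ℕ × ℕ → Bool := fun p => decide
    ((∃ a b : Set.Iio α, a < b ∧ e a = p.1 ∧ e b = p.2) ∨ p.2 ∉ Set.range e)
  have hr : ∀ m n, r (m, n) = true ↔
      ((∃ a b : Set.Iio α, a < b ∧ e a = m ∧ e b = n) ∨ n ∉ Set.range e) := by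
    intro m n; simp only [r, decide_eq_true_eq]
  have key : ∀ γ : Ordinal.{0}, ∀ hγ : γ < α, RK r γ (e ⟨γ, hγ⟩) := by
    intro γ
    induction γ using WellFoundedLT.induction with
    | ind γ ih =>
      intro hγ
      rw [RK]
      constructor
      · intro m hm
        rw [hr] at hm
        rcases hm with ⟨a, b, hab, rfl, hb⟩ | hm
        · have := he hb
          subst this
          exact ⟨a.1, hab, ih a.1 hab a.2⟩
        · exact absurd ⟨_, rfl⟩ hm
      · intro δ hδ
        refine ⟨e ⟨δ, hδ.trans hγ⟩, ?_, ih δ hδ _⟩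
        rw [hr]
        exact Or.inl ⟨_, _, hδ, rfl, rfl⟩
  refine ⟨r, fun γ => ⟨_, key γ.1 γ.2⟩, ?_⟩
  rintro ⟨n, hn⟩
  by_cases hne : n ∈ Set.range e
  · obtain ⟨a, rfl⟩ := hne
    exact absurd (RK_unique r _ _ _ (key a.1 a.2) hn) (ne_of_lt a.2)
  · have hn' := hn
    rw [RK] at hn'
    obtain ⟨γ, hγ, h2⟩ := hn'.1 n ((hr n n).2 (Or.inr hne))
    exact hγ.ne (RK_unique r _ _ _ h2 hn)

/-- There is a partition of the real line into exactly `ℵ₁` nonempty Borel sets: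
a family of `ℵ₁` pairwise disjoint nonempty Borel subsets of `ℝ` whose union is
all of `ℝ`. -/
theorem exists_partition_of_real_into_aleph_one_borel_sets :
    ∃ P : Set (Set ℝ),
      (∀ s ∈ P, s.Nonempty) ∧
      (∀ s ∈ P, MeasurableSet s) ∧
      P.PairwiseDisjoint id ∧
      ⋃₀ P = Set.univ ∧
      #P = Cardinal.aleph 1 := by
  have hX : ¬ Countable (ℕ × ℕ → Bool) := by
    rw [← Cardinal.mk_le_aleph0_iff]
    simp [Cardinal.aleph0_lt_continuum]
  have hR : ¬ Countable ℝ := by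
    rw [← Cardinal.mk_le_aleph0_iff]
    simp [Cardinal.aleph0_lt_continuum]
  let g : ℝ ≃ᵐ (ℕ × ℕ → Bool) := PolishSpace.measurableEquivOfNotCountable hR hX
  let F : Set.Iio (Ordinal.omega.{0} 1) → Set ℝ := fun α => g ⁻¹' (FB α.1)
  have hne : ∀ α, (F α).Nonempty := fun α => (FB_nonempty α.1 α.2).preimage g.surjective
  have hdis : ∀ α β x, x ∈ F α → x ∈ F β → α = β := fun α β x h h' =>
    Subtype.ext (FB_disj (g x) α.1 β.1 h h')
  refine ⟨Set.range F, ?_, ?_, ?_, ?_, ?_⟩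
  · rintro _ ⟨α, rfl⟩
    exact hne α
  · rintro _ ⟨α, rfl⟩
    exact g.measurable (FB_meas α.1 α.2)
  · rintro _ ⟨α, rfl⟩ _ ⟨β, rfl⟩ hab
    refine Set.disjoint_left.mpr fun x hx hx' => hab ?_
    rw [hdis α β x hx hx']
  · refine Set.eq_univ_of_forall fun x => ?_
    obtain ⟨α, hα, h⟩ := FB_cover (g x)
    exact ⟨F ⟨α, hα⟩, ⟨_, rfl⟩, h⟩
  · have hinj : Function.Injective F := by
      intro α β hab
      obtain ⟨x, hx⟩ := hne α
      exact hdis α β x hx (hab ▸ hx)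
    have := Cardinal.mk_range_eq_of_injective hinj
    rw [Cardinal.mk_Iio_ordinal] at this
    simpa using this
end

section
/- Suppose (F_α)_{α < ω₁} is a transfinite sequence of closed subsets of ℝ, indexed by the countable ordinals, whose union is all of ℝ, and suppose no countable subfamily covers ℝ. Then the sets F_α \ ⋃_{ξ < α} F_ξ are pairwise disjoint G_δ sets with union ℝ, and exactly ℵ₁ of them are nonempty; hence ℝ admits a partition into exactly ℵ₁ nonempty G_δ sets. -/
open Cardinal

/-- If `(F α)_{α < ω₁}` is a transfinite sequence of closed subsets of `ℝ`
covering `ℝ` such that no countable subfamily covers `ℝ`, then the sets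
`F α \ ⋃_{ξ < α} F ξ` are pairwise disjoint `Gδ` sets with union `ℝ`, exactly
`ℵ₁` of them are nonempty, and hence `ℝ` admits a partition into exactly `ℵ₁`
nonempty `Gδ` sets. -/
theorem partition_into_aleph_one_Gdelta_of_closed_cover
    (F : Ordinal.{0} → Set ℝ)
    (hcl : ∀ α, α < (Cardinal.aleph 1).ord → IsClosed (F α))
    (hcov : (⋃ α ∈ Set.Iio (Cardinal.aleph 1).ord, F α) = Set.univ)
    (hnocount : ∀ s : Set Ordinal.{0}, s ⊆ Set.Iio (Cardinal.aleph 1).ord →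
      s.Countable → (⋃ α ∈ s, F α) ≠ Set.univ) :
    (∀ α, α < (Cardinal.aleph 1).ord → IsGδ (F α \ ⋃ ξ ∈ Set.Iio α, F ξ)) ∧
    (Set.Iio (Cardinal.aleph 1).ord).PairwiseDisjoint
      (fun α => F α \ ⋃ ξ ∈ Set.Iio α, F ξ) ∧
    (⋃ α ∈ Set.Iio (Cardinal.aleph 1).ord, (F α \ ⋃ ξ ∈ Set.Iio α, F ξ)) = Set.univ ∧
    #{α : Ordinal.{0} | α < (Cardinal.aleph 1).ord ∧
        (F α \ ⋃ ξ ∈ Set.Iio α, F ξ).Nonempty} = Cardinal.aleph 1 ∧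
    ∃ P : Set (Set ℝ),
      (∀ s ∈ P, s.Nonempty) ∧
      (∀ s ∈ P, IsGδ s) ∧
      P.PairwiseDisjoint id ∧
      ⋃₀ P = Set.univ ∧
      #P = Cardinal.aleph 1 := by
  set D : Ordinal.{0} → Set ℝ := fun α => F α \ ⋃ ξ ∈ Set.Iio α, F ξ with hD
  have hcount : ∀ α : Ordinal.{0}, α < (Cardinal.aleph 1).ord → (Set.Iio α).Countable := by
    intro α hα
    rw [← Cardinal.le_aleph0_iff_set_countable, Cardinal.mk_Iio_ordinal,
      Cardinal.lift_le_aleph0]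
    rw [Cardinal.lt_ord, ← Cardinal.succ_aleph0, Order.lt_succ_iff] at hα
    exact hα
  have hG : ∀ α, α < (Cardinal.aleph 1).ord → IsGδ (D α) := by
    intro α hα
    have h : D α = F α ∩ ⋂ ξ ∈ Set.Iio α, (F ξ)ᶜ := by
      simp only [hD, Set.diff_eq, Set.compl_iUnion]
    rw [h]
    refine (hcl α hα).isGδ.inter (IsGδ.biInter (hcount α hα) ?_)
    intro ξ hξ
    exact (hcl ξ (lt_trans hξ hα)).isOpen_compl.isGδ
  have hlt : ∀ a b : Ordinal.{0}, a < b → Disjoint (D a) (D b) := by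
    intro a b hab
    rw [Set.disjoint_left]
    intro x hxa hxb
    exact hxb.2 (Set.mem_biUnion (show a ∈ Set.Iio b from hab) hxa.1)
  have hdisj : ∀ a b : Ordinal.{0}, a ≠ b → Disjoint (D a) (D b) := by
    intro a b hab
    rcases lt_or_gt_of_ne hab with h | h
    · exact hlt a b h
    · exact (hlt b a h).symm
  have hmem : ∀ x : ℝ, ∃ α, α < (Cardinal.aleph 1).ord ∧ x ∈ D α := by
    intro x
    have hx : x ∈ ⋃ α ∈ Set.Iio (Cardinal.aleph 1).ord, F α := by rw [hcov]; trivial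
    simp only [Set.mem_iUnion, Set.mem_Iio, exists_prop] at hx
    obtain ⟨α, ⟨hα, hxα⟩, hmin⟩ := WellFounded.has_min (wellFounded_lt (α := Ordinal.{0}))
      {α | α < (Cardinal.aleph 1).ord ∧ x ∈ F α} hx
    refine ⟨α, hα, hxα, ?_⟩
    simp only [Set.mem_iUnion, Set.mem_Iio, exists_prop, not_exists, not_and]
    intro ξ hξ hxξ
    exact hmin ξ ⟨hξ.trans hα, hxξ⟩ hξ
  set S : Set Ordinal.{0} := {α | α < (Cardinal.aleph 1).ord ∧ (D α).Nonempty} with hS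
  have hcard : #S = Cardinal.aleph 1 := by
    apply le_antisymm
    · calc #S ≤ #(Set.Iio (Cardinal.aleph.{0} 1).ord) := Cardinal.mk_le_mk_of_subset fun a ha => ha.1
        _ = Cardinal.aleph 1 := by
          rw [Cardinal.mk_Iio_ordinal, Cardinal.card_ord]; simp
    · rw [← Cardinal.succ_aleph0, Order.succ_le_iff]
      by_contra hc
      rw [not_lt, Cardinal.le_aleph0_iff_set_countable] at hc
      refine hnocount S (fun a ha => ha.1) hc ?_
      rw [Set.eq_univ_iff_forall]
      intro x
      obtain ⟨α, hα, hx⟩ := hmem x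
      exact Set.mem_biUnion (show α ∈ S from ⟨hα, x, hx⟩) hx.1
  have hinj : Set.InjOn D S := by
    intro a ha b hb hab
    by_contra hne
    obtain ⟨x, hx⟩ := ha.2
    exact Set.disjoint_left.1 (hdisj a b hne) hx (hab ▸ hx)
  refine ⟨hG, fun a _ b _ hab => hdisj a b hab, ?_, hcard, D '' S, ?_, ?_, ?_, ?_, ?_⟩
  · rw [Set.eq_univ_iff_forall]
    intro x
    obtain ⟨α, hα, hx⟩ := hmem x
    exact Set.mem_biUnion (show α ∈ Set.Iio _ from hα) hx
  · rintro _ ⟨a, ha, rfl⟩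
    exact ha.2
  · rintro _ ⟨a, ha, rfl⟩
    exact hG a ha.1
  · rintro _ ⟨a, ha, rfl⟩ _ ⟨b, hb, rfl⟩ hab
    exact hdisj a b fun h => hab (by rw [h])
  · rw [Set.eq_univ_iff_forall]
    intro x
    obtain ⟨α, hα, hx⟩ := hmem x
    exact ⟨D α, ⟨α, ⟨hα, x, hx⟩, rfl⟩, hx⟩
  · have h := Cardinal.mk_image_eq_of_injOn_lift D S hinj
    rw [hcard] at h
    apply Cardinal.lift_injective.{1, 0}
    rw [h]
    simp
end

section
/- Let P be a partition of the Cantor space 2^ω into uncountably many nonempty closed sets. Then there exists a nonempty closed subset X ⊆ 2^ω such that the nonempty sets among {K ∩ X : K ∈ P} form a partition of X into closed sets each of which is nowhere dense in the subspace X, and this restricted partition has the same cardinality as P. -/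
open Cardinal

/-- Given a partition `P` of the Cantor space into uncountably many nonempty
closed sets, there is a nonempty closed `X ⊆ 2^ω` such that the nonempty sets
among `{K ∩ X : K ∈ P}` form a partition of `X` into closed sets, each nowhere
dense in the subspace `X`, and this restricted partition has the same
cardinality as `P`. -/
theorem restrict_closed_partition_to_nowhere_dense
    (P : Set (Set (ℕ → Bool)))
    (hne : ∀ s ∈ P, s.Nonempty)
    (hcl : ∀ s ∈ P, IsClosed s)
    (hdisj : P.PairwiseDisjoint id)
    (hcov : ⋃₀ P = Set.univ)
    (hunc : ¬ P.Countable) :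
    ∃ X : Set (ℕ → Bool), X.Nonempty ∧ IsClosed X ∧
      (∀ s ∈ {s | ∃ K ∈ P, s = K ∩ X ∧ s.Nonempty},
        IsClosed s ∧ IsNowhereDense (Subtype.val ⁻¹' s : Set X)) ∧
      {s | ∃ K ∈ P, s = K ∩ X ∧ s.Nonempty}.PairwiseDisjoint id ∧
      ⋃₀ {s | ∃ K ∈ P, s = K ∩ X ∧ s.Nonempty} = X ∧
      #{s | ∃ K ∈ P, s = K ∩ X ∧ s.Nonempty} = #P := by
  classical
  let M : Set (ℕ → Bool) → Set (Set (ℕ → Bool)) := fun U => {K | K ∈ P ∧ (K ∩ U).Nonempty}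
  let S : Set (Set (ℕ → Bool)) := {U | IsOpen U ∧ (M U).Countable}
  obtain ⟨T, hTc, hTS, hTU⟩ := TopologicalSpace.isOpen_sUnion_countable S (fun U hU => hU.1)
  have hopen : IsOpen (⋃₀ S) := isOpen_sUnion (fun U hU => hU.1)
  have hMc : (M (⋃₀ S)).Countable := by
    have h : M (⋃₀ S) ⊆ ⋃ U ∈ T, M U := by
      rintro K ⟨hK, x, hxK, hx⟩
      rw [← hTU] at hx
      obtain ⟨U, hU, hxU⟩ := hx
      exact Set.mem_biUnion hU ⟨hK, x, hxK, hxU⟩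
    exact (hTc.biUnion (fun U hU => (hTS hU).2)).mono h
  let X : Set (ℕ → Bool) := (⋃₀ S)ᶜ
  have hXc : IsClosed X := hopen.isClosed_compl
  have hdiff : (P \ M X).Countable := by
    refine hMc.mono ?_
    rintro K ⟨hK, hn⟩
    obtain ⟨x, hx⟩ := hne K hK
    refine ⟨hK, x, hx, ?_⟩
    by_contra h
    exact hn ⟨hK, x, hx, h⟩
  have hsub : M X ⊆ P := fun K hK => hK.1
  have hun : M X ∪ P \ M X = P := Set.union_diff_cancel hsub
  have hMX : ¬ (M X).Countable := by
    intro h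
    apply hunc
    rw [← hun]
    exact h.union hdiff
  have huniq : ∀ K ∈ P, ∀ L ∈ P, ∀ x, x ∈ K → x ∈ L → K = L := by
    intro K hK L hL x hxK hxL
    by_contra hKL
    exact Set.disjoint_left.1 (hdisj hK hL hKL) hxK hxL
  have hR : {s | ∃ K ∈ P, s = K ∩ X ∧ s.Nonempty} = (fun K => K ∩ X) '' M X := by
    ext s
    constructor
    · rintro ⟨K, hK, rfl, h⟩
      exact ⟨K, ⟨hK, h⟩, rfl⟩
    · rintro ⟨K, ⟨hK, h⟩, rfl⟩
      exact ⟨K, hK, rfl, h⟩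
  refine ⟨X, ?_, hXc, ?_, ?_, ?_, ?_⟩
  · obtain ⟨K, -, x, -, hx⟩ : (M X).Nonempty := by
      rw [Set.nonempty_iff_ne_empty]
      intro h
      exact hMX (h ▸ Set.countable_empty)
    exact ⟨x, hx⟩
  · rintro s ⟨K, hK, rfl, -⟩
    have hc : IsClosed (K ∩ X) := (hcl K hK).inter hXc
    refine ⟨hc, ?_⟩
    rw [(hc.preimage continuous_subtype_val).isNowhereDense_iff, Set.eq_empty_iff_forall_notMem]
    rintro ⟨x, hxX⟩ hx
    obtain ⟨V, hVs, hV, hxV⟩ := mem_interior.1 hx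
    obtain ⟨U, hU, rfl⟩ := isOpen_induced_iff.1 hV
    apply hxX
    refine ⟨U, ⟨hU, (hMc.insert K).mono ?_⟩, hxV⟩
    rintro L ⟨hL, y, hyL, hyU⟩
    by_cases hy : y ∈ ⋃₀ S
    · exact Or.inr ⟨hL, y, hyL, hy⟩
    · left
      have : y ∈ K ∩ X := hVs (show (⟨y, hy⟩ : X) ∈ _ from hyU)
      exact huniq L hL K hK y hyL this.1
  · rintro s ⟨K, hK, rfl, -⟩ t ⟨L, hL, rfl, -⟩ hst
    refine Set.disjoint_left.2 ?_
    rintro x ⟨hxK, -⟩ ⟨hxL, -⟩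
    exact hst (by rw [huniq K hK L hL x hxK hxL])
  · ext x
    constructor
    · rintro ⟨s, ⟨K, hK, rfl, -⟩, hx⟩
      exact hx.2
    · intro hx
      have : x ∈ ⋃₀ P := hcov ▸ Set.mem_univ x
      obtain ⟨K, hK, hxK⟩ := this
      exact ⟨K ∩ X, ⟨K, hK, rfl, x, hxK, hx⟩, hxK, hx⟩
  · rw [hR, Cardinal.mk_image_eq_of_injOn]
    · apply le_antisymm (Cardinal.mk_le_mk_of_subset hsub)
      have h1 : ℵ₀ ≤ #(M X) := by
        by_contra h
        exact hMX (Cardinal.le_aleph0_iff_set_countable.1 (not_le.1 h).le)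
      have h2 : #(P \ M X : Set (Set (ℕ → Bool))) ≤ #(M X) :=
        (Cardinal.le_aleph0_iff_set_countable.2 hdiff).trans h1
      calc #P = #(M X ∪ P \ M X : Set (Set (ℕ → Bool))) := by rw [hun]
        _ ≤ #(M X) + #(P \ M X : Set (Set (ℕ → Bool))) := Cardinal.mk_union_le _ _
        _ = #(M X) := Cardinal.add_eq_left h1 h2
    · rintro K ⟨hK, x, hxK, hxX⟩ L ⟨hL, -⟩ h
      have : x ∈ L ∩ X := by
        have h' : K ∩ X = L ∩ X := h
        rw [← h']
        exact ⟨hxK, hxX⟩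
      exact huniq K hK L hL x hxK this.1
end

section
/- Let κ be an uncountable regular cardinal, let X be an uncountable Polish space admitting a partition P into exactly κ nonempty F_σ sets, and let Q be a partition of X into fewer than κ nonempty compact sets. Then there exists K ∈ Q such that the nonempty sets among {B ∩ K : B ∈ P} have cardinality exactly κ; in particular, K is an uncountable compact Polish space admitting a partition into exactly κ nonempty F_σ sets. -/
open Cardinal

universe u

/-- Let `κ` be an uncountable regular cardinal, `X` an uncountable Polish space
with a partition `P` into exactly `κ` nonempty `Fσ` sets, and `Q` a partition of
`X` into fewer than `κ` nonempty compact sets.  Then some `K ∈ Q` is such that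
the nonempty sets among `{B ∩ K : B ∈ P}` have cardinality exactly `κ`; in
particular `K` is uncountable and (as a compact Polish subspace) admits a
partition into exactly `κ` nonempty `Fσ` sets. -/
theorem exists_compact_piece_with_full_trace
    {X : Type u} [TopologicalSpace X] [PolishSpace X] [Uncountable X]
    (κ : Cardinal.{u}) (hκ : ℵ₀ < κ) (hreg : κ.IsRegular)
    (P : Set (Set X))
    (hPne : ∀ s ∈ P, s.Nonempty) (hPfs : ∀ s ∈ P, IsFsigma s)
    (hPdisj : P.PairwiseDisjoint id) (hPcov : ⋃₀ P = Set.univ)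
    (hPcard : #P = κ)
    (Q : Set (Set X))
    (hQne : ∀ s ∈ Q, s.Nonempty) (hQcomp : ∀ s ∈ Q, IsCompact s)
    (hQdisj : Q.PairwiseDisjoint id) (hQcov : ⋃₀ Q = Set.univ)
    (hQcard : #Q < κ) :
    ∃ K ∈ Q,
      #{s | ∃ B ∈ P, s = B ∩ K ∧ s.Nonempty} = κ ∧
      ¬ K.Countable ∧
      ∃ R : Set (Set ↥K),
        (∀ s ∈ R, s.Nonempty) ∧
        (∀ s ∈ R, IsFsigma s) ∧
        R.PairwiseDisjoint id ∧
        ⋃₀ R = Set.univ ∧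
        #R = κ := by
  classical
  have huniq : ∀ B ∈ P, ∀ C ∈ P, ∀ x, x ∈ B → x ∈ C → B = C := by
    intro B hB C hC x hxB hxC
    by_contra hne
    exact Set.disjoint_left.1 (hPdisj hB hC hne) hxB hxC
  let T : Set X → Set (Set X) := fun K => {B | B ∈ P ∧ (B ∩ K).Nonempty}
  have hPT : P = ⋃ K : Q, T K := by
    ext B
    simp only [Set.mem_iUnion]
    constructor
    · intro hB
      obtain ⟨x, hx⟩ := hPne B hB
      have hxu : x ∈ ⋃₀ Q := hQcov ▸ Set.mem_univ x
      obtain ⟨K, hK, hxK⟩ := hxu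
      exact ⟨⟨K, hK⟩, hB, x, hx, hxK⟩
    · rintro ⟨K, hB, -⟩
      exact hB
  have hex : ∃ K ∈ Q, #(T K) = κ := by
    by_contra hcon
    push Not at hcon
    have hlt : ∀ K : Q, #(T K) < κ := fun K =>
      lt_of_le_of_ne (hPcard ▸ Cardinal.mk_le_mk_of_subset (fun B hB => hB.1)) (hcon K K.2)
    have h2 : #(⋃ K : Q, T K) < κ :=
      (Cardinal.card_iUnion_lt_iff_forall_of_isRegular hreg hQcard).2 hlt
    rw [← hPT, hPcard] at h2
    exact lt_irrefl _ h2
  obtain ⟨K, hK, hTK⟩ := hex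
  refine ⟨K, hK, ?_, ?_, (fun B : Set X => (Subtype.val ⁻¹' B : Set K)) '' T K, ?_, ?_, ?_, ?_, ?_⟩
  · have himg : {s | ∃ B ∈ P, s = B ∩ K ∧ s.Nonempty} = (fun B => B ∩ K) '' T K := by
      ext s
      constructor
      · rintro ⟨B, hB, rfl, hs⟩
        exact ⟨B, ⟨hB, hs⟩, rfl⟩
      · rintro ⟨B, ⟨hB, hs⟩, rfl⟩
        exact ⟨B, hB, rfl, hs⟩
    rw [himg, Cardinal.mk_image_eq_of_injOn, hTK]
    rintro B ⟨hB, x, hxB, hxK⟩ C ⟨hC, -⟩ h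
    have hx : x ∈ C ∩ K := by
      have h' : B ∩ K = C ∩ K := h
      exact h' ▸ ⟨hxB, hxK⟩
    exact huniq B hB C hC x hxB hx.1
  · intro hcount
    have hc : #K ≤ ℵ₀ := Cardinal.le_aleph0_iff_set_countable.2 hcount
    have hle : #(T K) ≤ #K := by
      choose f hf using fun B : T K => B.2.2
      refine Cardinal.mk_le_of_injective (f := fun B : T K => (⟨f B, (hf B).2⟩ : K)) ?_
      intro B C h
      have h' : f B = f C := congrArg Subtype.val h
      exact Subtype.ext (huniq B B.2.1 C C.2.1 (f B) (hf B).1 (h' ▸ (hf C).1))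
    rw [hTK] at hle
    exact absurd hκ (not_lt.2 (hle.trans hc))
  · rintro _ ⟨B, ⟨hB, x, hxB, hxK⟩, rfl⟩
    exact ⟨⟨x, hxK⟩, hxB⟩
  · rintro _ ⟨B, ⟨hB, -⟩, rfl⟩
    obtain ⟨F, hF, rfl⟩ := hPfs B hB
    exact ⟨fun n => Subtype.val ⁻¹' F n, fun n => (hF n).preimage continuous_subtype_val,
      Set.preimage_iUnion⟩
  · rintro _ ⟨B, ⟨hB, -⟩, rfl⟩ _ ⟨C, ⟨hC, -⟩, rfl⟩ hne
    refine Set.disjoint_left.2 fun x hx hx' => hne ?_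
    rw [huniq B hB C hC x hx hx']
  · refine Set.eq_univ_of_forall fun x => ?_
    have hxu : (x : X) ∈ ⋃₀ P := hPcov ▸ Set.mem_univ _
    obtain ⟨B, hB, hxB⟩ := hxu
    exact ⟨_, ⟨B, ⟨hB, x, hxB, x.2⟩, rfl⟩, hxB⟩
  · rw [Cardinal.mk_image_eq_of_injOn, hTK]
    rintro B ⟨hB, x, hxB, hxK⟩ C ⟨hC, -⟩ h
    have hx : (⟨x, hxK⟩ : K) ∈ (Subtype.val ⁻¹' C : Set K) := by
      have h' : (Subtype.val ⁻¹' B : Set K) = Subtype.val ⁻¹' C := h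
      rw [← h']
      exact hxB
    exact huniq B hB C hC x hxB hx
end
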